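/- arXiv:math/0509070 — 2 statements merged into one kernel-verified Lean document; each statement's English description precedes it below -/
import Mathlib

section
/- Let a, b > 0 and let A, B, C : [0,a]×[0,b] → Matₙ(ℝ) be continuous matrix-valued functions. Fix (σ₀,τ₀) ∈ [0,a]×[0,b] and set Q := {(s,t) : σ₀ ≤ s ≤ a, τ₀ ≤ t ≤ b}. Then there exists a unique continuous matrix-valued function R : Q → Matₙ(ℝ), with continuous first partial derivatives R_s, R_t and continuous mixed second derivative R_{st} on Q, such that: R(σ₀,τ₀) = I; ∂R/∂s(s,τ₀) = C(s,τ₀) R(s,τ₀) for σ₀ ≤ s ≤ a; ∂R/∂t(σ₀,t) = B(σ₀,t) R(σ₀,t) for τ₀ ≤ t ≤ b; and ∂²R/∂s∂t(s,t) = A(s,t) R(s,t) + B(s,t) R_s(s,t) + C(s,t) R_t(s,t) on Q. -/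
open Set

attribute [local instance] Matrix.normedAddCommGroup Matrix.normedSpace

section RiemannAux

variable {E : Type*} [NormedAddCommGroup E] [NormedSpace ℝ E]

/-- lower-order right-hand side -/
noncomputable def rfF (A B C : ℝ × ℝ → E →L[ℝ] E) (w : ℝ × ℝ → E × E × E) (p : ℝ × ℝ) : E :=
  A p (w p).1 + B p (w p).2.1 + C p (w p).2.2

/-- the integral operator acting on triples `(R, R_s, R_t)` -/
noncomputable def rfG (x0 y0 : ℝ) (e : E) (A B C : ℝ × ℝ → E →L[ℝ] E) (b0 c0 : ℝ → E →L[ℝ] E)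
    (w : ℝ × ℝ → E × E × E) (p : ℝ × ℝ) : E × E × E :=
  (e + (∫ η in y0..p.2, (w (x0, η)).2.2) + (∫ ξ in x0..p.1, (w (ξ, p.2)).2.1),
   c0 p.1 (e + ∫ ξ in x0..p.1, (w (ξ, y0)).2.1) + ∫ η in y0..p.2, rfF A B C w (p.1, η),
   b0 p.2 (e + ∫ η in y0..p.2, (w (x0, η)).2.2) + ∫ ξ in x0..p.1, rfF A B C w (ξ, p.2))

theorem rfF_cont {A B C : ℝ × ℝ → E →L[ℝ] E} {w : ℝ × ℝ → E × E × E}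
    (hA : Continuous A) (hB : Continuous B) (hC : Continuous C) (hw : Continuous w) :
    Continuous (rfF A B C w) := by
  unfold rfF; fun_prop

theorem rf_int1 {f : ℝ × ℝ → E} (hf : Continuous f) (x0 : ℝ) :
    Continuous (fun p : ℝ × ℝ => ∫ ξ in x0..p.1, f (ξ, p.2)) := by
  apply intervalIntegral.continuous_parametric_intervalIntegral_of_continuous
    (f := fun (p : ℝ × ℝ) ξ => f (ξ, p.2))
  · simp only [Function.uncurry_def]; fun_prop
  · fun_prop

theorem rf_int2 {f : ℝ × ℝ → E} (hf : Continuous f) (y0 : ℝ) :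
    Continuous (fun p : ℝ × ℝ => ∫ η in y0..p.2, f (p.1, η)) := by
  apply intervalIntegral.continuous_parametric_intervalIntegral_of_continuous
    (f := fun (p : ℝ × ℝ) η => f (p.1, η))
  · simp only [Function.uncurry_def]; fun_prop
  · fun_prop

theorem rfG_cont {x0 y0 : ℝ} {e : E} {A B C : ℝ × ℝ → E →L[ℝ] E} {b0 c0 : ℝ → E →L[ℝ] E}
    {w : ℝ × ℝ → E × E × E}
    (hA : Continuous A) (hB : Continuous B) (hC : Continuous C) (hb : Continuous b0)
    (hc : Continuous c0) (hw : Continuous w) :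
    Continuous (rfG x0 y0 e A B C b0 c0 w) := by
  have h1 := rf_int1 (f := fun p => (w p).2.1) (by fun_prop) x0
  have h2 := rf_int2 (f := rfF A B C w) (rfF_cont hA hB hC hw) y0
  have h3 := rf_int1 (f := rfF A B C w) (rfF_cont hA hB hC hw) x0
  have h4 := rf_int2 (f := fun p => (w (x0, p.2)).2.2) (by fun_prop) y0
  have h5 := rf_int1 (f := fun p => (w (p.1, y0)).2.1) (by fun_prop) x0
  simp only at h1 h4 h5
  unfold rfG
  fun_prop

theorem rf_exp_int {f : ℝ → E} {x0 x D l c : ℝ} (hl : 0 < l) (hx : x0 ≤ x) (hD : 0 ≤ D)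
    (h : ∀ ξ ∈ Icc x0 x, ‖f ξ‖ ≤ D * Real.exp (l * (ξ + c))) :
    ‖∫ ξ in x0..x, f ξ‖ ≤ D / l * Real.exp (l * (x + c)) := by
  have hd : ∀ ξ ∈ uIcc x0 x, HasDerivAt (fun ξ => D / l * Real.exp (l * (ξ + c)))
      (D * Real.exp (l * (ξ + c))) ξ := by
    intro ξ _
    have := ((((hasDerivAt_id ξ).add_const c).const_mul l).exp).const_mul (D / l)
    refine this.congr_deriv ?_
    simp only [id]
    field_simp
  have hi : IntervalIntegrable (fun ξ => D * Real.exp (l * (ξ + c))) MeasureTheory.volume x0 x :=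
    Continuous.intervalIntegrable (by fun_prop) _ _
  have h1 := intervalIntegral.norm_integral_le_of_norm_le (f := f) hx
    (Filter.Eventually.of_forall fun t ht => h t ⟨ht.1.le, ht.2⟩) hi
  rw [intervalIntegral.integral_eq_sub_of_hasDerivAt hd hi] at h1
  have : 0 ≤ D / l * Real.exp (l * (x0 + c)) := by positivity
  linarith

theorem rfF_bound {A B C : ℝ × ℝ → E →L[ℝ] E} {w1 w2 : ℝ × ℝ → E × E × E} {K d : ℝ} {p : ℝ × ℝ}
    (hA : ‖A p‖ ≤ K) (hB : ‖B p‖ ≤ K) (hC : ‖C p‖ ≤ K) (h : ‖w1 p - w2 p‖ ≤ d) :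
    ‖rfF A B C w1 p - rfF A B C w2 p‖ ≤ 3 * K * d := by
  have e1 : rfF A B C w1 p - rfF A B C w2 p =
      A p (w1 p - w2 p).1 + B p (w1 p - w2 p).2.1 + C p (w1 p - w2 p).2.2 := by
    simp only [rfF, Prod.fst_sub, Prod.snd_sub, map_sub]; abel
  have hK : 0 ≤ K := (norm_nonneg _).trans hA
  have a1 : ‖(w1 p - w2 p).1‖ ≤ d := (norm_fst_le _).trans h
  have a2 : ‖(w1 p - w2 p).2‖ ≤ d := (norm_snd_le _).trans h
  have a3 : ‖(w1 p - w2 p).2.1‖ ≤ d := (norm_fst_le _).trans a2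
  have a4 : ‖(w1 p - w2 p).2.2‖ ≤ d := (norm_snd_le _).trans a2
  rw [e1]
  have b1 := (A p).le_of_opNorm_le_of_le hA a1
  have b2 := (B p).le_of_opNorm_le_of_le hB a3
  have b3 := (C p).le_of_opNorm_le_of_le hC a4
  refine (norm_add₃_le).trans ?_
  linarith

theorem rfG_contract {x0 y0 a b : ℝ} {e : E} {A B C : ℝ × ℝ → E →L[ℝ] E} {b0 c0 : ℝ → E →L[ℝ] E}
    {w1 w2 : ℝ × ℝ → E × E × E} {K l D : ℝ}
    (hA : Continuous A) (hB : Continuous B) (hC : Continuous C)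
    (hw1 : Continuous w1) (hw2 : Continuous w2)
    (kA : ∀ p, ‖A p‖ ≤ K) (kB : ∀ p, ‖B p‖ ≤ K) (kC : ∀ p, ‖C p‖ ≤ K)
    (kb : ∀ p, ‖b0 p‖ ≤ K) (kc : ∀ p, ‖c0 p‖ ≤ K) (hl : l = 8 * K + 8) (hD : 0 ≤ D)
    (h : ∀ p ∈ Icc x0 a ×ˢ Icc y0 b, ‖w1 p - w2 p‖ ≤ D * Real.exp (l * (p.1 + p.2 - x0 - y0)))
    (p : ℝ × ℝ) (hp : p ∈ Icc x0 a ×ˢ Icc y0 b) :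
    ‖rfG x0 y0 e A B C b0 c0 w1 p - rfG x0 y0 e A B C b0 c0 w2 p‖
      ≤ D / 2 * Real.exp (l * (p.1 + p.2 - x0 - y0)) := by
  obtain ⟨s, t⟩ := p
  obtain ⟨⟨hs1, hs2⟩, ht1, ht2⟩ := hp
  simp only at hs1 hs2 ht1 ht2
  have hK : 0 ≤ K := (norm_nonneg _).trans (kA (0, 0))
  have hl0 : 0 < l := by linarith
  have h1 : ∀ p ∈ Icc x0 a ×ˢ Icc y0 b,
      ‖(w1 p).2.1 - (w2 p).2.1‖ ≤ D * Real.exp (l * (p.1 + p.2 - x0 - y0)) := fun p hp =>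
    ((norm_fst_le (w1 p - w2 p).2).trans (norm_snd_le _)).trans (h p hp)
  have h2 : ∀ p ∈ Icc x0 a ×ˢ Icc y0 b,
      ‖(w1 p).2.2 - (w2 p).2.2‖ ≤ D * Real.exp (l * (p.1 + p.2 - x0 - y0)) := fun p hp =>
    ((norm_snd_le (w1 p - w2 p).2).trans (norm_snd_le _)).trans (h p hp)
  have hF : ∀ p ∈ Icc x0 a ×ˢ Icc y0 b,
      ‖rfF A B C w1 p - rfF A B C w2 p‖ ≤
        (3 * K * D) * Real.exp (l * (p.1 + p.2 - x0 - y0)) := fun p hp => by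
    rw [mul_assoc]; exact rfF_bound (kA p) (kB p) (kC p) (h p hp)
  have cF1 := rfF_cont hA hB hC hw1
  have cF2 := rfF_cont hA hB hC hw2
  set Ex := Real.exp (l * (s + t - x0 - y0)) with hEx
  have hEx0 : 0 < Ex := Real.exp_pos _
  have mono : ∀ z, z ≤ s + t - x0 - y0 → ∀ d, 0 ≤ d → d * Real.exp (l * z) ≤ d * Ex := by
    intro z hz d hd
    rw [hEx]; gcongr
  -- the five integral estimates
  have i1 : ‖(∫ η in y0..t, (w1 (x0, η)).2.2) - ∫ η in y0..t, (w2 (x0, η)).2.2‖ ≤ D / l * Ex := by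
    rw [← intervalIntegral.integral_sub (Continuous.intervalIntegrable (by fun_prop) _ _)
      (Continuous.intervalIntegrable (by fun_prop) _ _)]
    refine (rf_exp_int (c := - y0) hl0 ht1 hD fun η hη => ?_).trans
      (mono _ (by linarith) _ (by positivity))
    refine (h2 (x0, η) ⟨⟨le_rfl, hs1.trans hs2⟩, hη.1, hη.2.trans ht2⟩).trans (le_of_eq ?_)
    simp only; congr 3; ring
  have i2 : ‖(∫ ξ in x0..s, (w1 (ξ, t)).2.1) - ∫ ξ in x0..s, (w2 (ξ, t)).2.1‖ ≤ D / l * Ex := by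
    rw [← intervalIntegral.integral_sub (Continuous.intervalIntegrable (by fun_prop) _ _)
      (Continuous.intervalIntegrable (by fun_prop) _ _)]
    refine (rf_exp_int (c := t - x0 - y0) hl0 hs1 hD fun η hη => ?_).trans
      (mono _ (by linarith) _ (by positivity))
    refine (h1 (η, t) ⟨⟨hη.1, hη.2.trans hs2⟩, ht1, ht2⟩).trans (le_of_eq ?_)
    simp only; congr 3; ring
  have i3 : ‖(∫ ξ in x0..s, (w1 (ξ, y0)).2.1) - ∫ ξ in x0..s, (w2 (ξ, y0)).2.1‖ ≤ D / l * Ex := by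
    rw [← intervalIntegral.integral_sub (Continuous.intervalIntegrable (by fun_prop) _ _)
      (Continuous.intervalIntegrable (by fun_prop) _ _)]
    refine (rf_exp_int (c := - x0) hl0 hs1 hD fun η hη => ?_).trans
      (mono _ (by linarith) _ (by positivity))
    refine (h1 (η, y0) ⟨⟨hη.1, hη.2.trans hs2⟩, le_rfl, ht1.trans ht2⟩).trans (le_of_eq ?_)
    simp only; congr 3; ring
  have i4 : ‖(∫ η in y0..t, rfF A B C w1 (s, η)) - ∫ η in y0..t, rfF A B C w2 (s, η)‖
      ≤ (3 * K * D) / l * Ex := by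
    rw [← intervalIntegral.integral_sub (Continuous.intervalIntegrable (by fun_prop) _ _)
      (Continuous.intervalIntegrable (by fun_prop) _ _)]
    refine (rf_exp_int (c := s - x0 - y0) hl0 ht1 (by positivity) fun η hη => ?_).trans
      (mono _ (by linarith) _ (by positivity))
    refine (hF (s, η) ⟨⟨hs1, hs2⟩, hη.1, hη.2.trans ht2⟩).trans (le_of_eq ?_)
    simp only; congr 3; ring
  have i5 : ‖(∫ ξ in x0..s, rfF A B C w1 (ξ, t)) - ∫ ξ in x0..s, rfF A B C w2 (ξ, t)‖
      ≤ (3 * K * D) / l * Ex := by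
    rw [← intervalIntegral.integral_sub (Continuous.intervalIntegrable (by fun_prop) _ _)
      (Continuous.intervalIntegrable (by fun_prop) _ _)]
    refine (rf_exp_int (c := t - x0 - y0) hl0 hs1 (by positivity) fun η hη => ?_).trans
      (mono _ (by linarith) _ (by positivity))
    refine (hF (η, t) ⟨⟨hη.1, hη.2.trans hs2⟩, ht1, ht2⟩).trans (le_of_eq ?_)
    simp only; congr 3; ring
  have n1 : D / l * Ex + D / l * Ex ≤ D / 2 * Ex := by
    rw [← add_mul]
    gcongr
    rw [← add_div, div_le_div_iff₀ hl0 two_pos, hl]; nlinarith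
  have n2 : K * (D / l * Ex) + (3 * K * D) / l * Ex ≤ D / 2 * Ex := by
    have : K * (D / l * Ex) + (3 * K * D) / l * Ex = ((4 * K * D) / l) * Ex := by ring
    rw [this]
    refine mul_le_mul_of_nonneg_right ?_ hEx0.le
    rw [div_le_div_iff₀ hl0 two_pos, hl]; nlinarith
  rw [Prod.norm_def, Prod.norm_def]
  refine max_le ?_ (max_le ?_ ?_)
  · refine le_trans ?_ ((add_le_add i1 i2).trans n1)
    refine le_trans (le_of_eq ?_) (norm_add_le _ _)
    simp only [rfG, Prod.fst_sub]
    congr 1; abel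
  · refine le_trans ?_ ((add_le_add ((c0 s).le_of_opNorm_le_of_le (kc s) i3) i4).trans n2)
    refine le_trans (le_of_eq ?_) (norm_add_le _ _)
    simp only [rfG, Prod.fst_sub, Prod.snd_sub, map_sub, map_add]
    congr 1; abel
  · refine le_trans ?_ ((add_le_add ((b0 t).le_of_opNorm_le_of_le (kb t) i1) i5).trans n2)
    refine le_trans (le_of_eq ?_) (norm_add_le _ _)
    simp only [rfG, Prod.snd_sub, map_sub, map_add]
    congr 1; abel

/-- uniqueness for the integral system -/
theorem rfG_unique {x0 y0 a b : ℝ} {e : E} {A B C : ℝ × ℝ → E →L[ℝ] E} {b0 c0 : ℝ → E →L[ℝ] E}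
    {w1 w2 : ℝ × ℝ → E × E × E} {K : ℝ}
    (hA : Continuous A) (hB : Continuous B) (hC : Continuous C)
    (hw1 : Continuous w1) (hw2 : Continuous w2)
    (kA : ∀ p, ‖A p‖ ≤ K) (kB : ∀ p, ‖B p‖ ≤ K) (kC : ∀ p, ‖C p‖ ≤ K)
    (kb : ∀ p, ‖b0 p‖ ≤ K) (kc : ∀ p, ‖c0 p‖ ≤ K)
    (h1 : ∀ p ∈ Icc x0 a ×ˢ Icc y0 b, w1 p = rfG x0 y0 e A B C b0 c0 w1 p)
    (h2 : ∀ p ∈ Icc x0 a ×ˢ Icc y0 b, w2 p = rfG x0 y0 e A B C b0 c0 w2 p)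
    (p : ℝ × ℝ) (hp : p ∈ Icc x0 a ×ˢ Icc y0 b) : w1 p = w2 p := by
  have hK : 0 ≤ K := (norm_nonneg _).trans (kA (0, 0))
  obtain ⟨D, hD⟩ := (isCompact_Icc.prod isCompact_Icc).exists_bound_of_continuousOn
    (s := Icc x0 a ×ˢ Icc y0 b) (f := fun p => w1 p - w2 p) (by fun_prop)
  have hD0 : 0 ≤ D := (norm_nonneg _).trans (hD p hp)
  have key : ∀ k : ℕ, ∀ p ∈ Icc x0 a ×ˢ Icc y0 b,
      ‖w1 p - w2 p‖ ≤ D / 2 ^ k * Real.exp ((8 * K + 8) * (p.1 + p.2 - x0 - y0)) := by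
    intro k
    induction k with
    | zero =>
      intro p hp
      have : 1 ≤ Real.exp ((8 * K + 8) * (p.1 + p.2 - x0 - y0)) := by
        apply Real.one_le_exp
        have := hp.1.1
        have := hp.2.1
        apply mul_nonneg <;> linarith
      have := hD p hp
      simp only [pow_zero, div_one]
      nlinarith
    | succ k ih =>
      intro p hp
      rw [h1 p hp, h2 p hp]
      have := rfG_contract (e := e) hA hB hC hw1 hw2 kA kB kC kb kc rfl (by positivity) ih p hp
      rwa [div_div, ← pow_succ] at this
  have lim : Filter.Tendsto
      (fun k : ℕ => D / 2 ^ k * Real.exp ((8 * K + 8) * (p.1 + p.2 - x0 - y0))) Filter.atTop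
      (nhds 0) := by
    have := (tendsto_pow_atTop_nhds_zero_of_lt_one (r := (1 / 2 : ℝ)) (by norm_num)
      (by norm_num)).const_mul D
    have := this.mul_const (Real.exp ((8 * K + 8) * (p.1 + p.2 - x0 - y0)))
    simpa [div_eq_mul_inv] using this
  have := ge_of_tendsto' lim fun k => key k p hp
  exact sub_eq_zero.mp (norm_le_zero_iff.mp this)

/-- projection to the rectangle -/
noncomputable def rfP (x0 a y0 b : ℝ) (p : ℝ × ℝ) : ℝ × ℝ := (max x0 (min a p.1), max y0 (min b p.2))

theorem rfP_cont (x0 a y0 b : ℝ) : Continuous (rfP x0 a y0 b) := by unfold rfP; fun_prop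

theorem rfP_mem {x0 a y0 b : ℝ} (h1 : x0 ≤ a) (h2 : y0 ≤ b) (p : ℝ × ℝ) :
    rfP x0 a y0 b p ∈ Icc x0 a ×ˢ Icc y0 b := by
  simp [rfP, h1, h2]

theorem rfP_eq {x0 a y0 b : ℝ} {p : ℝ × ℝ} (hp : p ∈ Icc x0 a ×ˢ Icc y0 b) :
    rfP x0 a y0 b p = p := by
  obtain ⟨⟨hs1, hs2⟩, ht1, ht2⟩ := hp
  simp [rfP, hs1, hs2, ht1, ht2]

/-- existence for the integral system -/
theorem rfG_exists [CompleteSpace E] {x0 y0 a b : ℝ} (hxa : x0 ≤ a) (hyb : y0 ≤ b)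
    {e : E} {A B C : ℝ × ℝ → E →L[ℝ] E} {b0 c0 : ℝ → E →L[ℝ] E} {K : ℝ}
    (hA : Continuous A) (hB : Continuous B) (hC : Continuous C)
    (hb : Continuous b0) (hc : Continuous c0)
    (kA : ∀ p, ‖A p‖ ≤ K) (kB : ∀ p, ‖B p‖ ≤ K) (kC : ∀ p, ‖C p‖ ≤ K)
    (kb : ∀ p, ‖b0 p‖ ≤ K) (kc : ∀ p, ‖c0 p‖ ≤ K) :
    ∃ w : ℝ × ℝ → E × E × E, Continuous w ∧
      ∀ p ∈ Icc x0 a ×ˢ Icc y0 b, w p = rfG x0 y0 e A B C b0 c0 w p := by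
  set l := 8 * K + 8 with hl
  let wt : ℝ × ℝ → ℝ := fun p => Real.exp (l * (p.1 + p.2 - x0 - y0))
  have wt_cont : Continuous wt := by fun_prop
  have wt_pos : ∀ p, 0 < wt p := fun p => Real.exp_pos _
  let π := rfP x0 a y0 b
  have hπ : Continuous π := rfP_cont ..
  let H : (ℝ × ℝ → E × E × E) → ℝ × ℝ → E × E × E := fun w p =>
    (wt p)⁻¹ • rfG x0 y0 e A B C b0 c0 (fun q => wt q • w q) p
  have H_cont : ∀ w, Continuous w → Continuous (H w) := by
    intro w hw
    have := rfG_cont (x0 := x0) (y0 := y0) (e := e) hA hB hC hb hc (wt_cont.smul hw)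
    exact (wt_cont.inv₀ fun p => (wt_pos p).ne').smul this
  have H_bd : ∀ w, Continuous w → ∃ D, ∀ p, ‖H w (π p)‖ ≤ D := by
    intro w hw
    obtain ⟨D, hD⟩ := (isCompact_Icc.prod isCompact_Icc).exists_bound_of_continuousOn
      (s := Icc x0 a ×ˢ Icc y0 b) (f := H w) (H_cont w hw).continuousOn
    exact ⟨D, fun p => hD _ (rfP_mem hxa hyb p)⟩
  choose! bd hbd using H_bd
  let T : BoundedContinuousFunction (ℝ × ℝ) (E × E × E) →
      BoundedContinuousFunction (ℝ × ℝ) (E × E × E) := fun w =>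
    BoundedContinuousFunction.ofNormedAddCommGroup (fun p => H w (π p))
      ((H_cont w w.continuous).comp hπ) (bd w) (hbd w w.continuous)
  have hT : ContractingWith (1 / 2) T := by
    refine ⟨by norm_num [← NNReal.coe_lt_coe], LipschitzWith.of_dist_le_mul fun w1 w2 => ?_⟩
    have : 0 ≤ dist w1 w2 := dist_nonneg
    rw [BoundedContinuousFunction.dist_le (by positivity)]
    intro p
    change dist (H w1 (π p)) (H w2 (π p)) ≤ _
    have hq : π p ∈ Icc x0 a ×ˢ Icc y0 b := rfP_mem hxa hyb p
    generalize π p = q at hq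
    have := rfG_contract (e := e) (D := dist w1 w2) hA hB hC (wt_cont.smul w1.continuous)
      (wt_cont.smul w2.continuous) kA kB kC kb kc hl this ?_ q hq
    · change ‖_‖ ≤ _ * wt q at this
      simp only [H]
      rw [dist_eq_norm, ← smul_sub, norm_smul, norm_inv, Real.norm_of_nonneg (wt_pos q).le,
        inv_mul_le_iff₀ (wt_pos q)]
      refine this.trans (le_of_eq ?_)
      push_cast; ring
    · intro r _
      change ‖wt r • w1 r - wt r • w2 r‖ ≤ _ * wt r
      rw [← smul_sub, norm_smul, Real.norm_of_nonneg (wt_pos r).le, mul_comm, ← dist_eq_norm]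
      have := wt_pos r
      gcongr
      exact BoundedContinuousFunction.dist_coe_le_dist r
  let w := ContractingWith.fixedPoint T hT
  have hw : T w = w := hT.fixedPoint_isFixedPt
  refine ⟨fun q => wt q • w q, wt_cont.smul w.continuous, fun p hp => ?_⟩
  have h1 : H w (π p) = w p := congrArg (fun f => f p) hw
  have h2 : π p = p := rfP_eq hp
  rw [h2] at h1
  simp only
  rw [← h1]
  simp only [H]
  rw [smul_inv_smul₀ (wt_pos p).ne']

theorem rf_swap {W : ℝ × ℝ → E} (hW : Continuous W) (x0 x y0 y : ℝ) :
    (∫ ξ in x0..x, ∫ η in y0..y, W (ξ, η)) = ∫ η in y0..y, ∫ ξ in x0..x, W (ξ, η) := by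
  apply MeasureTheory.intervalIntegral_intervalIntegral_swap (F := fun ξ η => W (ξ, η))
  have : Continuous (Function.uncurry fun ξ η => W (ξ, η)) := hW
  exact (this.continuousOn.integrableOn_compact
    (isCompact_uIcc.prod isCompact_uIcc)).mono_set (prod_mono uIoc_subset_uIcc uIoc_subset_uIcc)

theorem rf_ftc1 [CompleteSpace E] {f : ℝ → E} (hf : Continuous f) (x0 x : ℝ) :
    HasDerivAt (fun u => ∫ ξ in x0..u, f ξ) (f x) x :=
  (hf.integral_hasStrictDerivAt x0 x).hasDerivAt

/-- derivative in `t` of `∫ U(ξ,t) dξ` when `U(ξ,t) = u(ξ) + ∫ W(ξ,η) dη`. -/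
theorem rf_diff [CompleteSpace E] {W : ℝ × ℝ → E} (hW : Continuous W) {u : ℝ → E}
    (hu : Continuous u) {U : ℝ × ℝ → E} {x0 y0 a b : ℝ}
    (hU : ∀ p ∈ Icc x0 a ×ˢ Icc y0 b, U p = u p.1 + ∫ η in y0..p.2, W (p.1, η))
    {s t : ℝ} (hs : s ∈ Icc x0 a) (ht : t ∈ Icc y0 b) :
    HasDerivWithinAt (fun t => ∫ ξ in x0..s, U (ξ, t)) (∫ ξ in x0..s, W (ξ, t)) (Icc y0 b) t := by
  have h1 : ∀ t ∈ Icc y0 b, (∫ ξ in x0..s, U (ξ, t)) =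
      (∫ ξ in x0..s, u ξ) + ∫ η in y0..t, ∫ ξ in x0..s, W (ξ, η) := by
    intro t ht
    rw [← rf_swap hW, ← intervalIntegral.integral_add]
    · apply intervalIntegral.integral_congr
      intro ξ hξ
      rw [uIcc_of_le hs.1] at hξ
      exact hU (ξ, t) ⟨⟨hξ.1, hξ.2.trans hs.2⟩, ht⟩
    · exact hu.intervalIntegrable _ _
    · apply Continuous.intervalIntegrable
      exact (rf_int2 hW y0).comp (f := fun ξ : ℝ => (ξ, t)) (by fun_prop)
  have hc : Continuous fun η => ∫ ξ in x0..s, W (ξ, η) :=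
    (rf_int1 hW x0).comp (f := fun η : ℝ => (s, η)) (by fun_prop)
  exact (((rf_ftc1 hc y0 t).const_add _).hasDerivWithinAt).congr h1 (h1 t ht)

theorem rf_ftc2 [CompleteSpace E] {f f' : ℝ → E} {x0 a x : ℝ} (hx : x ∈ Icc x0 a)
    (h : ∀ y ∈ Icc x0 a, HasDerivWithinAt f (f' y) (Icc x0 a) y) (hf' : Continuous f') :
    f x = f x0 + ∫ ξ in x0..x, f' ξ := by
  rw [intervalIntegral.integral_eq_sub_of_hasDerivAt_of_le hx.1 (f := f)]
  · abel
  · intro y hy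
    exact ((h y ⟨hy.1, hy.2.trans hx.2⟩).continuousWithinAt).mono (Icc_subset_Icc_right hx.2)
  · intro y hy
    exact (h y ⟨hy.1.le, hy.2.le.trans hx.2⟩).hasDerivAt
      (Icc_mem_nhds hy.1 (hy.2.trans_le hx.2))
  · exact hf'.intervalIntegrable _ _

/-- the solution predicate -/
def rfSol (x0 a y0 b : ℝ) (e : E) (A B C : ℝ × ℝ → E →L[ℝ] E) (R Rs Rt Rst : ℝ × ℝ → E) : Prop :=
  ContinuousOn R (Icc x0 a ×ˢ Icc y0 b) ∧ ContinuousOn Rs (Icc x0 a ×ˢ Icc y0 b) ∧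
  ContinuousOn Rt (Icc x0 a ×ˢ Icc y0 b) ∧ ContinuousOn Rst (Icc x0 a ×ˢ Icc y0 b) ∧
  (∀ p ∈ Icc x0 a ×ˢ Icc y0 b, HasDerivWithinAt (fun s => R (s, p.2)) (Rs p) (Icc x0 a) p.1) ∧
  (∀ p ∈ Icc x0 a ×ˢ Icc y0 b, HasDerivWithinAt (fun t => R (p.1, t)) (Rt p) (Icc y0 b) p.2) ∧
  (∀ p ∈ Icc x0 a ×ˢ Icc y0 b, HasDerivWithinAt (fun t => Rs (p.1, t)) (Rst p) (Icc y0 b) p.2) ∧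
  R (x0, y0) = e ∧
  (∀ s ∈ Icc x0 a, Rs (s, y0) = C (s, y0) (R (s, y0))) ∧
  (∀ t ∈ Icc y0 b, Rt (x0, t) = B (x0, t) (R (x0, t))) ∧
  (∀ p ∈ Icc x0 a ×ˢ Icc y0 b, Rst p = A p (R p) + B p (Rs p) + C p (Rt p))

theorem rfSol_exists [CompleteSpace E] {x0 y0 a b : ℝ} (hxa : x0 ≤ a) (hyb : y0 ≤ b)
    {e : E} {A B C : ℝ × ℝ → E →L[ℝ] E} {K : ℝ}
    (hA : Continuous A) (hB : Continuous B) (hC : Continuous C)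
    (kA : ∀ p, ‖A p‖ ≤ K) (kB : ∀ p, ‖B p‖ ≤ K) (kC : ∀ p, ‖C p‖ ≤ K) :
    ∃ R Rs Rt Rst, rfSol x0 a y0 b e A B C R Rs Rt Rst := by
  obtain ⟨w, hw, hG⟩ := rfG_exists (e := e) hxa hyb hA hB hC (b0 := fun t => B (x0, t))
    (c0 := fun s => C (s, y0)) (by fun_prop) (by fun_prop) kA kB kC (fun t => kB _) (fun s => kC _)
  have hF := rfF_cont hA hB hC hw
  have eR : ∀ p ∈ Icc x0 a ×ˢ Icc y0 b, (w p).1 =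
      e + (∫ η in y0..p.2, (w (x0, η)).2.2) + (∫ ξ in x0..p.1, (w (ξ, p.2)).2.1) :=
    fun p hp => congrArg (fun z => z.1) (hG p hp)
  have eU : ∀ p ∈ Icc x0 a ×ˢ Icc y0 b, (w p).2.1 =
      C (p.1, y0) (e + ∫ ξ in x0..p.1, (w (ξ, y0)).2.1) +
        ∫ η in y0..p.2, rfF A B C w (p.1, η) :=
    fun p hp => congrArg (fun z => z.2.1) (hG p hp)
  have eV : ∀ p ∈ Icc x0 a ×ˢ Icc y0 b, (w p).2.2 =
      B (x0, p.2) (e + ∫ η in y0..p.2, (w (x0, η)).2.2) +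
        ∫ ξ in x0..p.1, rfF A B C w (ξ, p.2) :=
    fun p hp => congrArg (fun z => z.2.2) (hG p hp)
  have mx : x0 ∈ Icc x0 a := ⟨le_rfl, hxa⟩
  have my : y0 ∈ Icc y0 b := ⟨le_rfl, hyb⟩
  have eV0 : ∀ t ∈ Icc y0 b, (w (x0, t)).2.2 =
      B (x0, t) (e + ∫ η in y0..t, (w (x0, η)).2.2) := by
    intro t ht
    have := eV (x0, t) ⟨mx, ht⟩
    simpa using this
  refine ⟨fun p => (w p).1, fun p => (w p).2.1, fun p => (w p).2.2, rfF A B C w,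
    by fun_prop, by fun_prop, by fun_prop, by fun_prop, ?_, ?_, ?_, ?_, ?_, ?_, ?_⟩
  · rintro ⟨s, t⟩ ⟨hs, ht⟩
    have := ((rf_ftc1 (f := fun ξ => (w (ξ, t)).2.1) (by fun_prop) x0 s).const_add
      (e + (∫ η in y0..t, (w (x0, η)).2.2))).hasDerivWithinAt (s := Icc x0 a)
    exact this.congr (fun s hs => eR (s, t) ⟨hs, ht⟩) (eR (s, t) ⟨hs, ht⟩)
  · rintro ⟨s, t⟩ ⟨hs, ht⟩
    have h1 := ((rf_ftc1 (f := fun η => (w (x0, η)).2.2) (by fun_prop) y0 t).const_add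
      e).hasDerivWithinAt (s := Icc y0 b)
    have hu : Continuous fun s => C (s, y0) (e + ∫ ξ in x0..s, (w (ξ, y0)).2.1) := by
      have := (rf_int1 (f := fun p => (w p).2.1) (by fun_prop) x0).comp
        (f := fun s : ℝ => (s, y0)) (by fun_prop)
      simp only [Function.comp_def] at this
      fun_prop
    have h2 := rf_diff hF hu (U := fun p => (w p).2.1) eU hs ht
    have h3 := (h1.add h2).congr (f₁ := fun t => (w (s, t)).1)
      (fun t ht => eR (s, t) ⟨hs, ht⟩) (eR (s, t) ⟨hs, ht⟩)
    convert h3 using 1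
    rw [eV0 t ht]
    exact eV (s, t) ⟨hs, ht⟩
  · rintro ⟨s, t⟩ ⟨hs, ht⟩
    have := ((rf_ftc1 (f := fun η => rfF A B C w (s, η)) (by fun_prop) y0 t).const_add
      (C (s, y0) (e + ∫ ξ in x0..s, (w (ξ, y0)).2.1))).hasDerivWithinAt (s := Icc y0 b)
    exact this.congr (fun t ht => eU (s, t) ⟨hs, ht⟩) (eU (s, t) ⟨hs, ht⟩)
  · simpa using eR (x0, y0) ⟨mx, my⟩
  · intro s hs
    have h1 := eU (s, y0) ⟨hs, my⟩
    have h2 := eR (s, y0) ⟨hs, my⟩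
    simp only [intervalIntegral.integral_same, add_zero] at h1 h2
    simp only
    rw [h1, h2]
  · intro t ht
    have h2 := eR (x0, t) ⟨mx, ht⟩
    simp only [intervalIntegral.integral_same, add_zero] at h2
    simp only
    rw [eV0 t ht, h2]
  · intro p hp
    rfl

theorem rfSol_unique [CompleteSpace E] {x0 y0 a b : ℝ} (hxa : x0 ≤ a) (hyb : y0 ≤ b)
    {e : E} {A B C : ℝ × ℝ → E →L[ℝ] E} {K : ℝ}
    (hA : Continuous A) (hB : Continuous B) (hC : Continuous C)
    (kA : ∀ p, ‖A p‖ ≤ K) (kB : ∀ p, ‖B p‖ ≤ K) (kC : ∀ p, ‖C p‖ ≤ K)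
    {R Rs Rt Rst R' Rs' Rt' Rst' : ℝ × ℝ → E}
    (h : rfSol x0 a y0 b e A B C R Rs Rt Rst) (h' : rfSol x0 a y0 b e A B C R' Rs' Rt' Rst') :
    EqOn R R' (Icc x0 a ×ˢ Icc y0 b) := by
  have mx : x0 ∈ Icc x0 a := ⟨le_rfl, hxa⟩
  have my : y0 ∈ Icc y0 b := ⟨le_rfl, hyb⟩
  -- each solution, extended by projection
  have ext : ∀ f : ℝ × ℝ → E, ContinuousOn f (Icc x0 a ×ˢ Icc y0 b) →
      ∃ g, Continuous g ∧ EqOn f g (Icc x0 a ×ˢ Icc y0 b) := fun f hf =>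
    ⟨f ∘ rfP x0 a y0 b, hf.comp_continuous (rfP_cont ..) (rfP_mem hxa hyb),
      fun p hp => by simp [rfP_eq hp]⟩
  have main : ∀ R Rs Rt Rst : ℝ × ℝ → E, rfSol x0 a y0 b e A B C R Rs Rt Rst →
      ∃ r u v : ℝ × ℝ → E, Continuous r ∧ Continuous u ∧ Continuous v ∧
        EqOn R r (Icc x0 a ×ˢ Icc y0 b) ∧
        (∀ s ∈ Icc x0 a, r (s, y0) = e + ∫ ξ in x0..s, u (ξ, y0)) ∧
        (∀ s ∈ Icc x0 a, u (s, y0) = C (s, y0) (r (s, y0))) ∧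
        (y0 < b → ∀ p ∈ Icc x0 a ×ˢ Icc y0 b, (r p, u p, v p) =
          rfG x0 y0 e A B C (fun t => B (x0, t)) (fun s => C (s, y0))
            (fun p => (r p, u p, v p)) p) := by
    rintro R Rs Rt Rst ⟨c1, c2, c3, c4, d1, d2, d3, i0, i1, i2, i3⟩
    obtain ⟨r, cr, er⟩ := ext R c1
    obtain ⟨u, cu, eu⟩ := ext Rs c2
    obtain ⟨v, cv, ev⟩ := ext Rt c3
    have d1' : ∀ s ∈ Icc x0 a, ∀ t ∈ Icc y0 b,
        HasDerivWithinAt (fun s => r (s, t)) (u (s, t)) (Icc x0 a) s := by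
      intro s hs t ht
      rw [← eu ⟨hs, ht⟩]
      exact (d1 (s, t) ⟨hs, ht⟩).congr (fun s hs => (er ⟨hs, ht⟩).symm) (er ⟨hs, ht⟩).symm
    have d2' : ∀ s ∈ Icc x0 a, ∀ t ∈ Icc y0 b,
        HasDerivWithinAt (fun t => r (s, t)) (v (s, t)) (Icc y0 b) t := by
      intro s hs t ht
      rw [← ev ⟨hs, ht⟩]
      exact (d2 (s, t) ⟨hs, ht⟩).congr (fun t ht => (er ⟨hs, ht⟩).symm) (er ⟨hs, ht⟩).symm
    have d3' : ∀ s ∈ Icc x0 a, ∀ t ∈ Icc y0 b,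
        HasDerivWithinAt (fun t => u (s, t)) (rfF A B C (fun p => (r p, u p, v p)) (s, t))
          (Icc y0 b) t := by
      intro s hs t ht
      have := i3 (s, t) ⟨hs, ht⟩
      rw [er ⟨hs, ht⟩, eu ⟨hs, ht⟩, ev ⟨hs, ht⟩] at this
      rw [rfF, ← this]
      exact (d3 (s, t) ⟨hs, ht⟩).congr (fun t ht => (eu ⟨hs, ht⟩).symm) (eu ⟨hs, ht⟩).symm
    have i0' : r (x0, y0) = e := by rw [← er ⟨mx, my⟩, i0]
    have i1' : ∀ s ∈ Icc x0 a, u (s, y0) = C (s, y0) (r (s, y0)) := by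
      intro s hs
      rw [← er ⟨hs, my⟩, ← eu ⟨hs, my⟩, i1 s hs]
    have i2' : ∀ t ∈ Icc y0 b, v (x0, t) = B (x0, t) (r (x0, t)) := by
      intro t ht
      rw [← er ⟨mx, ht⟩, ← ev ⟨mx, ht⟩, i2 t ht]
    have cF := rfF_cont hA hB hC (w := fun p => (r p, u p, v p)) (by fun_prop)
    have e1 : ∀ s ∈ Icc x0 a, ∀ t ∈ Icc y0 b, r (s, t) = r (x0, t) + ∫ ξ in x0..s, u (ξ, t) :=
      fun s hs t ht => rf_ftc2 (f := fun s => r (s, t)) hs (fun s hs => d1' s hs t ht)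
        (by fun_prop)
    have e2 : ∀ t ∈ Icc y0 b, r (x0, t) = e + ∫ η in y0..t, v (x0, η) := fun t ht => by
      rw [← i0']
      exact rf_ftc2 (f := fun t => r (x0, t)) ht (fun t ht => d2' x0 mx t ht) (by fun_prop)
    have e3 : ∀ s ∈ Icc x0 a, ∀ t ∈ Icc y0 b, u (s, t) = u (s, y0) +
        ∫ η in y0..t, rfF A B C (fun p => (r p, u p, v p)) (s, η) :=
      fun s hs t ht => rf_ftc2 (f := fun t => u (s, t)) ht (fun t ht => d3' s hs t ht)
        (by fun_prop)
    have e4 : ∀ s ∈ Icc x0 a, r (s, y0) = e + ∫ ξ in x0..s, u (ξ, y0) := fun s hs => by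
      rw [e1 s hs y0 my, i0']
    refine ⟨r, u, v, cr, cu, cv, er, e4, i1', ?_⟩
    rintro hlt ⟨s, t⟩ ⟨hs, ht⟩
    simp only at hs ht
    have e5 : v (s, t) = v (x0, t) +
        ∫ ξ in x0..s, rfF A B C (fun p => (r p, u p, v p)) (ξ, t) := by
      have h1 := rf_diff cF (u := fun s => u (s, y0)) (by fun_prop) (U := u)
        (fun p hp => e3 p.1 hp.1 p.2 hp.2) hs ht
      have h2 := ((d2' x0 mx t ht).add h1).congr (f₁ := fun t => r (s, t))
        (fun t ht => e1 s hs t ht) (e1 s hs t ht)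
      exact (uniqueDiffOn_Icc hlt t ht).eq_deriv _ (d2' s hs t ht) h2
    refine Prod.ext ?_ (Prod.ext ?_ ?_)
    · simp only [rfG]
      rw [e1 s hs t ht, e2 t ht]
    · simp only [rfG]
      rw [e3 s hs t ht, i1' s hs, e4 s hs]
    · simp only [rfG]
      rw [e5, i2' t ht, e2 t ht]
  obtain ⟨r1, u1, v1, cr1, cu1, cv1, er1, f1, g1, k1⟩ := main _ _ _ _ h
  obtain ⟨r2, u2, v2, cr2, cu2, cv2, er2, f2, g2, k2⟩ := main _ _ _ _ h'
  intro p hp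
  rw [er1 hp, er2 hp]
  rcases hyb.lt_or_eq with hlt | heq
  · have := rfG_unique (e := e) hA hB hC (w1 := fun p => (r1 p, u1 p, v1 p))
      (w2 := fun p => (r2 p, u2 p, v2 p)) (by fun_prop) (by fun_prop) kA kB kC
      (b0 := fun t => B (x0, t)) (c0 := fun s => C (s, y0)) (fun t => kB _) (fun s => kC _)
      (k1 hlt) (k2 hlt) p hp
    exact congrArg Prod.fst this
  · have hK : 0 ≤ K := (norm_nonneg _).trans (kA (0, 0))
    subst heq
    have k : ∀ r u : ℝ × ℝ → E, (∀ s ∈ Icc x0 a, r (s, y0) = e + ∫ ξ in x0..s, u (ξ, y0)) →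
        (∀ s ∈ Icc x0 a, u (s, y0) = C (s, y0) (r (s, y0))) →
        ∀ p ∈ Icc x0 a ×ˢ Icc y0 y0, (r p, u p, (0 : E)) =
          rfG x0 y0 e 0 0 0 0 (fun s => C (s, y0)) (fun p => (r p, u p, (0 : E))) p := by
      rintro r u f g ⟨s, t⟩ ⟨hs, ht⟩
      obtain rfl : t = y0 := by simpa using ht
      refine Prod.ext ?_ (Prod.ext ?_ ?_)
      · simp [rfG, f s hs]
      · simp only [rfG, intervalIntegral.integral_same, add_zero]
        rw [g s hs, f s hs]
      · simp [rfG, rfF]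
    have := rfG_unique (e := e) (A := 0) (B := 0) (C := 0) (K := K) continuous_zero
      continuous_zero continuous_zero
      (w1 := fun p => (r1 p, u1 p, (0 : E)))
      (w2 := fun p => (r2 p, u2 p, (0 : E))) (by fun_prop) (by fun_prop) (by simpa using hK)
      (by simpa using hK) (by simpa using hK)
      (b0 := 0) (c0 := fun s => C (s, y0)) (by simpa using hK) (fun s => kC _)
      (k r1 u1 f1 g1) (k r2 u2 f2 g2) p hp
    exact congrArg Prod.fst this

theorem rfSol_congr {x0 y0 a b : ℝ} (hxa : x0 ≤ a) (hyb : y0 ≤ b)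
    {e : E} {A B C A' B' C' : ℝ × ℝ → E →L[ℝ] E}
    (hA : EqOn A A' (Icc x0 a ×ˢ Icc y0 b)) (hB : EqOn B B' (Icc x0 a ×ˢ Icc y0 b))
    (hC : EqOn C C' (Icc x0 a ×ˢ Icc y0 b)) {R Rs Rt Rst : ℝ × ℝ → E}
    (h : rfSol x0 a y0 b e A B C R Rs Rt Rst) : rfSol x0 a y0 b e A' B' C' R Rs Rt Rst := by
  obtain ⟨c1, c2, c3, c4, d1, d2, d3, i0, i1, i2, i3⟩ := h
  have mx : x0 ∈ Icc x0 a := ⟨le_rfl, hxa⟩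
  have my : y0 ∈ Icc y0 b := ⟨le_rfl, hyb⟩
  refine ⟨c1, c2, c3, c4, d1, d2, d3, i0, fun s hs => ?_, fun t ht => ?_, fun p hp => ?_⟩
  · rw [← hC ⟨hs, my⟩]; exact i1 s hs
  · rw [← hB ⟨mx, ht⟩]; exact i2 t ht
  · rw [← hA hp, ← hB hp, ← hC hp]; exact i3 p hp

theorem rfSol_main [CompleteSpace E] {x0 y0 a b : ℝ} (hxa : x0 ≤ a) (hyb : y0 ≤ b)
    {e : E} {A B C : ℝ × ℝ → E →L[ℝ] E}
    (hA : ContinuousOn A (Icc x0 a ×ˢ Icc y0 b)) (hB : ContinuousOn B (Icc x0 a ×ˢ Icc y0 b))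
    (hC : ContinuousOn C (Icc x0 a ×ˢ Icc y0 b)) :
    ∃ R, (∃ Rs Rt Rst, rfSol x0 a y0 b e A B C R Rs Rt Rst) ∧
      ∀ R', (∃ Rs' Rt' Rst', rfSol x0 a y0 b e A B C R' Rs' Rt' Rst') →
        EqOn R R' (Icc x0 a ×ˢ Icc y0 b) := by
  have ext : ∀ f : ℝ × ℝ → E →L[ℝ] E, ContinuousOn f (Icc x0 a ×ˢ Icc y0 b) →
      ∃ g, Continuous g ∧ EqOn f g (Icc x0 a ×ˢ Icc y0 b) ∧ ∃ K, ∀ p, ‖g p‖ ≤ K := by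
    intro f hf
    obtain ⟨K, hK⟩ := (isCompact_Icc.prod isCompact_Icc).exists_bound_of_continuousOn hf
    exact ⟨f ∘ rfP x0 a y0 b, hf.comp_continuous (rfP_cont ..) (rfP_mem hxa hyb),
      fun p hp => by simp [rfP_eq hp], K, fun p => hK _ (rfP_mem hxa hyb p)⟩
  obtain ⟨A', cA, eA, KA, kA⟩ := ext A hA
  obtain ⟨B', cB, eB, KB, kB⟩ := ext B hB
  obtain ⟨C', cC, eC, KC, kC⟩ := ext C hC
  have kA' : ∀ p, ‖A' p‖ ≤ max KA (max KB KC) := fun p => (kA p).trans (le_max_left _ _)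
  have kB' : ∀ p, ‖B' p‖ ≤ max KA (max KB KC) := fun p =>
    (kB p).trans ((le_max_left _ _).trans (le_max_right _ _))
  have kC' : ∀ p, ‖C' p‖ ≤ max KA (max KB KC) := fun p =>
    (kC p).trans ((le_max_right _ _).trans (le_max_right _ _))
  obtain ⟨R, Rs, Rt, Rst, h⟩ := rfSol_exists (e := e) hxa hyb cA cB cC kA' kB' kC'
  refine ⟨R, ⟨Rs, Rt, Rst, rfSol_congr hxa hyb eA.symm eB.symm eC.symm h⟩, ?_⟩
  rintro R' ⟨Rs', Rt', Rst', h'⟩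
  exact rfSol_unique hxa hyb cA cB cC kA' kB' kC' h (rfSol_congr hxa hyb eA eB eC h')

end RiemannAux

/-- left multiplication as a linear map into continuous linear maps -/
noncomputable def rfL (n : ℕ) : Matrix (Fin n) (Fin n) ℝ →ₗ[ℝ]
    (Matrix (Fin n) (Fin n) ℝ →L[ℝ] Matrix (Fin n) (Fin n) ℝ) :=
  (LinearMap.toContinuousLinearMap (𝕜 := ℝ) (E := Matrix (Fin n) (Fin n) ℝ)
    (F' := Matrix (Fin n) (Fin n) ℝ)).toLinearMap.comp (LinearMap.mul ℝ (Matrix (Fin n) (Fin n) ℝ))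

theorem rfL_apply (n : ℕ) (X Y : Matrix (Fin n) (Fin n) ℝ) : rfL n X Y = X * Y := rfl

theorem rfL_cont (n : ℕ) : Continuous (rfL n) := LinearMap.continuous_of_finiteDimensional _

/-- Existence and uniqueness of the matrix-valued Riemann function with base
point `(σ₀,τ₀)` for the linear Goursat–Darboux operator `∂²/∂s∂t − A − B ∂/∂s − C ∂/∂t`. -/
theorem riemann_function_exists_unique
    (n : ℕ) (a b : ℝ) (ha : 0 < a) (hb : 0 < b)
    (A B C : ℝ × ℝ → Matrix (Fin n) (Fin n) ℝ)
    (hA : ContinuousOn A (Icc 0 a ×ˢ Icc 0 b))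
    (hB : ContinuousOn B (Icc 0 a ×ˢ Icc 0 b))
    (hC : ContinuousOn C (Icc 0 a ×ˢ Icc 0 b))
    (σ₀ τ₀ : ℝ) (hσ₀ : σ₀ ∈ Icc (0:ℝ) a) (hτ₀ : τ₀ ∈ Icc (0:ℝ) b)
    (Q : Set (ℝ × ℝ)) (hQ : Q = Icc σ₀ a ×ˢ Icc τ₀ b) :
    ∃ R : ℝ × ℝ → Matrix (Fin n) (Fin n) ℝ,
      (∃ Rs Rt Rst : ℝ × ℝ → Matrix (Fin n) (Fin n) ℝ,
        ContinuousOn R Q ∧ ContinuousOn Rs Q ∧ ContinuousOn Rt Q ∧ ContinuousOn Rst Q ∧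
        (∀ p ∈ Q, HasDerivWithinAt (fun s => R (s, p.2)) (Rs p) (Icc σ₀ a) p.1) ∧
        (∀ p ∈ Q, HasDerivWithinAt (fun t => R (p.1, t)) (Rt p) (Icc τ₀ b) p.2) ∧
        (∀ p ∈ Q, HasDerivWithinAt (fun t => Rs (p.1, t)) (Rst p) (Icc τ₀ b) p.2) ∧
        R (σ₀, τ₀) = 1 ∧
        (∀ s ∈ Icc σ₀ a, Rs (s, τ₀) = C (s, τ₀) * R (s, τ₀)) ∧
        (∀ t ∈ Icc τ₀ b, Rt (σ₀, t) = B (σ₀, t) * R (σ₀, t)) ∧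
        (∀ p ∈ Q, Rst p = A p * R p + B p * Rs p + C p * Rt p)) ∧
      ∀ R' : ℝ × ℝ → Matrix (Fin n) (Fin n) ℝ,
        (∃ Rs' Rt' Rst' : ℝ × ℝ → Matrix (Fin n) (Fin n) ℝ,
          ContinuousOn R' Q ∧ ContinuousOn Rs' Q ∧ ContinuousOn Rt' Q ∧ ContinuousOn Rst' Q ∧
          (∀ p ∈ Q, HasDerivWithinAt (fun s => R' (s, p.2)) (Rs' p) (Icc σ₀ a) p.1) ∧
          (∀ p ∈ Q, HasDerivWithinAt (fun t => R' (p.1, t)) (Rt' p) (Icc τ₀ b) p.2) ∧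
          (∀ p ∈ Q, HasDerivWithinAt (fun t => Rs' (p.1, t)) (Rst' p) (Icc τ₀ b) p.2) ∧
          R' (σ₀, τ₀) = 1 ∧
          (∀ s ∈ Icc σ₀ a, Rs' (s, τ₀) = C (s, τ₀) * R' (s, τ₀)) ∧
          (∀ t ∈ Icc τ₀ b, Rt' (σ₀, t) = B (σ₀, t) * R' (σ₀, t)) ∧
          (∀ p ∈ Q, Rst' p = A p * R' p + B p * Rs' p + C p * Rt' p)) →
        Set.EqOn R R' Q := by
  subst hQ
  have hsub : Icc σ₀ a ×ˢ Icc τ₀ b ⊆ Icc 0 a ×ˢ Icc 0 b :=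
    prod_mono (Icc_subset_Icc_left hσ₀.1) (Icc_subset_Icc_left hτ₀.1)
  exact rfSol_main (e := (1 : Matrix (Fin n) (Fin n) ℝ)) hσ₀.2 hτ₀.2
    ((rfL_cont n).comp_continuousOn (hA.mono hsub))
    ((rfL_cont n).comp_continuousOn (hB.mono hsub))
    ((rfL_cont n).comp_continuousOn (hC.mono hsub))
end

section
/- Let a, b > 0 and let A, B, C : [0,a]×[0,b] → Matₙ(ℝ) be continuous. For each base point (σ,τ) ∈ [0,a]×[0,b] let R(·,·,σ,τ) be the matrix-valued Riemann function, i.e. the unique function on {(s,t) : σ ≤ s ≤ a, τ ≤ t ≤ b} with continuous first partials and continuous mixed second derivative satisfying R(σ,τ,σ,τ) = I, ∂_s R(s,τ,σ,τ) = C(s,τ)R(s,τ,σ,τ), ∂_t R(σ,t,σ,τ) = B(σ,t)R(σ,t,σ,τ), and ∂²R/∂s∂t = A R + B ∂_s R + C ∂_t R. Let w : [0,a]×[0,b] → ℝⁿ be continuous. Then the function y(s,t) := ∫₀ˢ ∫₀ᵗ R(s,t,σ,τ) w(σ,τ) dτ dσ is the unique function with continuous first partials and continuous mixed second derivative satisfying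 ∂²y/∂s∂t = A(s,t) y + B(s,t) ∂y/∂s + C(s,t) ∂y/∂t + w(s,t) on [0,a]×[0,b] together with the zero characteristic data y(s,0) = 0 for 0 ≤ s ≤ a and y(0,t) = 0 for 0 ≤ t ≤ b. -/
open Set MeasureTheory

section RiemannAux

variable {V : Type*} [NormedAddCommGroup V] [NormedSpace ℝ V]

/-- Continuity of parametric interval integrals with two moving endpoints. -/
lemma aux_cont_param {X : Type*} [TopologicalSpace X] (f : X → ℝ → V)
    (hf : Continuous (fun p : X × ℝ => f p.1 p.2)) (l u : X → ℝ) (hl : Continuous l)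
    (hu : Continuous u) : Continuous fun x => ∫ t in (l x)..(u x), f x t := by
  have h : (fun x => ∫ t in (l x)..(u x), f x t) =
      fun x => (∫ t in (0:ℝ)..(u x), f x t) - ∫ t in (0:ℝ)..(l x), f x t := by
    funext x
    have hx : Continuous (f x) := hf.comp (by fun_prop : Continuous fun t : ℝ => (x, t))
    exact (intervalIntegral.integral_interval_sub_left (hx.intervalIntegrable _ _)
      (hx.intervalIntegrable _ _)).symm
  rw [h]
  exact (intervalIntegral.continuous_parametric_intervalIntegral_of_continuous hf hu).sub
    (intervalIntegral.continuous_parametric_intervalIntegral_of_continuous hf hl)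

/-- Swap of interval integrals of a continuous function. -/
lemma aux_swap (f : ℝ → ℝ → V) (hf : Continuous (fun p : ℝ × ℝ => f p.1 p.2)) (a b c d : ℝ) :
    ∫ x in a..b, ∫ y in c..d, f x y = ∫ y in c..d, ∫ x in a..b, f x y := by
  apply intervalIntegral_intervalIntegral_swap
  have : IntegrableOn (Function.uncurry f) (uIcc a b ×ˢ uIcc c d) :=
    (hf.continuousOn).integrableOn_compact (isCompact_uIcc.prod isCompact_uIcc)
  exact this.mono_set (prod_mono uIoc_subset_uIcc uIoc_subset_uIcc)

/-- The exponential weight estimate. -/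
lemma aux_exp_bound (g : ℝ → V) (c s lam M : ℝ) (hlam : 0 < lam) (hM : 0 ≤ M)
    (hb : ∀ x ∈ uIcc c s, ‖g x‖ ≤ M * Real.exp (lam * |x - c|)) :
    ‖∫ x in c..s, g x‖ ≤ M * Real.exp (lam * |s - c|) / lam := by
  have key : ∀ (g : ℝ → V) (d : ℝ), 0 ≤ d →
      (∀ x ∈ Icc 0 d, ‖g x‖ ≤ M * Real.exp (lam * x)) →
      ‖∫ x in (0:ℝ)..d, g x‖ ≤ M * Real.exp (lam * d) / lam := by
    intro g d hd hg
    have hI : ∫ x in (0:ℝ)..d, M * Real.exp (lam * x) = M * Real.exp (lam * d) / lam - M / lam := by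
      rw [intervalIntegral.integral_eq_sub_of_hasDerivAt (f := fun x => M * Real.exp (lam * x) / lam)]
      · simp
      · intro x _
        have h1 : HasDerivAt (fun x : ℝ => lam * x) lam x := by
          simpa using (hasDerivAt_id x).const_mul lam
        have h2 := ((h1.exp).const_mul M).div_const lam
        have e : M * (Real.exp (lam * x) * lam) / lam = M * Real.exp (lam * x) := by
          field_simp
        rw [e] at h2
        exact h2
      · exact Continuous.intervalIntegrable (by fun_prop) _ _
    have h := intervalIntegral.norm_integral_le_of_norm_le (μ := volume) hd
      (f := g) (g := fun x => M * Real.exp (lam * x))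
      (Filter.Eventually.of_forall fun x hx => hg x ⟨hx.1.le, hx.2⟩)
      (Continuous.intervalIntegrable (by fun_prop) _ _)
    rw [hI] at h
    have : 0 ≤ M / lam := by positivity
    linarith
  rcases le_total c s with h | h
  · have h1 := key (fun x => g (x + c)) (s - c) (by linarith) (by
      intro x hx
      have := hb (x + c) (by rw [uIcc_of_le h]; constructor <;> linarith [hx.1, hx.2])
      simpa [abs_of_nonneg hx.1] using this)
    rw [intervalIntegral.integral_comp_add_right] at h1
    rw [abs_of_nonneg (by linarith : (0:ℝ) ≤ s - c)]
    simpa using h1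
  · have h1 := key (fun x => g (c - x)) (c - s) (by linarith) (by
      intro x hx
      have := hb (c - x) (by rw [uIcc_of_ge h]; constructor <;> linarith [hx.1, hx.2])
      simpa [abs_of_nonneg hx.1] using this)
    rw [intervalIntegral.integral_comp_sub_left] at h1
    rw [abs_of_nonpos (by linarith : s - c ≤ 0), intervalIntegral.integral_symm, norm_neg]
    simpa using h1

/-- Leibniz rule. -/
lemma aux_leibniz [CompleteSpace V] (k : ℝ → V) (hk : Continuous k) (h : ℝ → ℝ → V)
    (hh : Continuous (fun p : ℝ × ℝ => h p.1 p.2)) (s₀ : ℝ) :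
    HasDerivAt (fun s => ∫ σ in (0:ℝ)..s, (k σ + ∫ x in σ..s, h x σ))
      (k s₀ + ∫ σ in (0:ℝ)..s₀, h s₀ σ) s₀ := by
  have hP : Continuous (fun p : ℝ × ℝ × ℝ => ∫ x in p.1..p.2.1, h x p.2.2) :=
    aux_cont_param (fun (p : ℝ × ℝ × ℝ) x => h x p.2.2)
      (hh.comp (by fun_prop : Continuous fun p : (ℝ × ℝ × ℝ) × ℝ => (p.2, p.1.2.2)))
      _ _ (by fun_prop) (by fun_prop)
  have hP' : ∀ s, Continuous fun σ => ∫ x in σ..s, h x σ := fun s =>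
    hP.comp (by fun_prop : Continuous fun σ : ℝ => (σ, s, σ))
  have hP'' : ∀ s, Continuous fun σ => ∫ x in s₀..s, h x σ := fun s =>
    hP.comp (by fun_prop : Continuous fun σ : ℝ => (s₀, s, σ))
  have hx : ∀ x, Continuous fun σ => h σ x := fun x =>
    hh.comp (by fun_prop : Continuous fun σ : ℝ => (σ, x))
  have hsplit : (fun s => ∫ σ in (0:ℝ)..s, (k σ + ∫ x in σ..s, h x σ)) =
      fun s => (∫ σ in (0:ℝ)..s, k σ) + ((∫ σ in s₀..s, ∫ x in σ..s, h x σ) +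
        ((∫ x in s₀..s, ∫ σ in (0:ℝ)..s₀, h x σ) + ∫ σ in (0:ℝ)..s₀, ∫ x in σ..s₀, h x σ)) := by
    funext s
    rw [intervalIntegral.integral_add (hk.intervalIntegrable _ _) ((hP' s).intervalIntegrable _ _)]
    congr 1
    rw [aux_swap h hh, ← intervalIntegral.integral_add ((hP'' s).intervalIntegrable _ _)
      ((hP' s₀).intervalIntegrable _ _), add_comm,
      ← intervalIntegral.integral_add_adjacent_intervals ((hP' s).intervalIntegrable 0 s₀)
      ((hP' s).intervalIntegrable s₀ s)]
    congr 1
    apply intervalIntegral.integral_congr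
    intro σ _
    simp only
    rw [add_comm, intervalIntegral.integral_add_adjacent_intervals
      ((hx σ).intervalIntegrable _ _) ((hx σ).intervalIntegrable _ _)]
  rw [hsplit]
  have h1 : HasDerivAt (fun s => ∫ σ in (0:ℝ)..s, k σ) (k s₀) s₀ :=
    hk.integral_hasStrictDerivAt _ _ |>.hasDerivAt
  have hc : Continuous fun x => ∫ σ in (0:ℝ)..s₀, h x σ :=
    aux_cont_param h hh _ _ (by fun_prop) (by fun_prop)
  have h2 : HasDerivAt (fun s => ∫ x in s₀..s, ∫ σ in (0:ℝ)..s₀, h x σ)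
      (∫ σ in (0:ℝ)..s₀, h s₀ σ) s₀ := hc.integral_hasStrictDerivAt _ _ |>.hasDerivAt
  have h3 : HasDerivAt (fun s => ∫ σ in s₀..s, ∫ x in σ..s, h x σ) 0 s₀ := by
    obtain ⟨δ, hδ, hb⟩ : ∃ δ > 0, ∀ x σ, |x - s₀| < δ → |σ - s₀| < δ →
        ‖h x σ‖ ≤ ‖h s₀ s₀‖ + 1 := by
      obtain ⟨δ, hδ, hb⟩ := Metric.continuousAt_iff.1 (hh.continuousAt (x := (s₀, s₀))) 1 one_pos
      refine ⟨δ, hδ, fun x σ h1 h2 => ?_⟩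
      have := hb (x := (x, σ)) (by simpa [Prod.dist_eq, Real.dist_eq] using ⟨h1, h2⟩)
      rw [dist_eq_norm] at this
      have h3 := norm_le_insert' (h x σ) (h s₀ s₀)
      simp only at this
      linarith
    have hb2 : ∀ s, |s - s₀| < δ →
        ‖∫ σ in s₀..s, ∫ x in σ..s, h x σ‖ ≤ (‖h s₀ s₀‖ + 1) * |s - s₀| * |s - s₀| := by
      intro s hs
      apply intervalIntegral.norm_integral_le_of_norm_le_const
      intro σ hσ
      have hσ' := uIoc_subset_uIcc hσ
      have e1 : |σ - s₀| ≤ |s - s₀| := abs_sub_left_of_mem_uIcc hσ'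
      have e2 : |s - σ| ≤ |s - s₀| := abs_sub_right_of_mem_uIcc hσ'
      refine (intervalIntegral.norm_integral_le_of_norm_le_const (C := ‖h s₀ s₀‖ + 1) ?_).trans ?_
      · intro x hx
        have hx' : x ∈ uIcc s₀ s := uIcc_subset_uIcc hσ' right_mem_uIcc (uIoc_subset_uIcc hx)
        exact hb x σ ((abs_sub_left_of_mem_uIcc hx').trans_lt hs) (e1.trans_lt hs)
      · gcongr
    rw [hasDerivAt_iff_isLittleO]
    simp only [intervalIntegral.integral_same, sub_zero, smul_zero]
    rw [Asymptotics.isLittleO_iff]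
    intro c hc
    have hev : ∀ᶠ s in nhds s₀, |s - s₀| < min δ (c / (‖h s₀ s₀‖ + 1)) := by
      have := Metric.ball_mem_nhds s₀ (ε := min δ (c / (‖h s₀ s₀‖ + 1))) (by positivity)
      filter_upwards [this] with s hs
      simpa [Real.dist_eq] using hs
    filter_upwards [hev] with s hs
    refine (hb2 s (hs.trans_le (min_le_left _ _))).trans ?_
    rw [Real.norm_eq_abs]
    gcongr
    have := hs.le.trans (min_le_right _ _)
    rw [le_div_iff₀ (by positivity)] at this
    linarith
  have h4 := h1.add (h3.add (h2.add_const (∫ σ in (0:ℝ)..s₀, ∫ x in σ..s₀, h x σ)))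
  rw [zero_add] at h4
  exact h4

/-- The right-hand side `A r + B v + C u` along a triple of functions. -/
def auxF (A B C : ℝ × ℝ → V →L[ℝ] V) (g : ℝ × ℝ × ℝ × ℝ → V × V × V) (x : ℝ × ℝ × ℝ × ℝ) : V :=
  A (x.1, x.2.1) (g x).1 + B (x.1, x.2.1) (g x).2.1 + C (x.1, x.2.1) (g x).2.2

/-- The linear Volterra operator of the Goursat problem with moving base point. -/
noncomputable def auxL (A B C : ℝ × ℝ → V →L[ℝ] V) (g : ℝ × ℝ × ℝ × ℝ → V × V × V)
    (p : ℝ × ℝ × ℝ × ℝ) : V × V × V :=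
  ((∫ x in p.2.2.1..p.1, (g (x, p.2.2.2, p.2.2.1, p.2.2.2)).2.1) +
      ∫ x in p.2.2.2..p.2.1, (g (p.1, x, p.2.2.1, p.2.2.2)).2.2,
    C (p.1, p.2.2.2) (∫ x in p.2.2.1..p.1, (g (x, p.2.2.2, p.2.2.1, p.2.2.2)).2.1) +
      ∫ x in p.2.2.2..p.2.1, auxF A B C g (p.1, x, p.2.2.1, p.2.2.2),
    B (p.2.2.1, p.2.1) (∫ x in p.2.2.2..p.2.1, (g (p.2.2.1, x, p.2.2.1, p.2.2.2)).2.2) +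
      ∫ x in p.2.2.1..p.1, auxF A B C g (x, p.2.1, p.2.2.1, p.2.2.2))

/-- The inhomogeneity of the Volterra equation. -/
def auxG (B C : ℝ × ℝ → V →L[ℝ] V) (w : ℝ × ℝ → V) (p : ℝ × ℝ × ℝ × ℝ) : V × V × V :=
  (w p.2.2, C (p.1, p.2.2.2) (w p.2.2), B (p.2.2.1, p.2.1) (w p.2.2))

/-- The exponential weight. -/
noncomputable def auxE (lam : ℝ) (p : ℝ × ℝ × ℝ × ℝ) : ℝ :=
  Real.exp (lam * |p.1 - p.2.2.1|) * Real.exp (lam * |p.2.1 - p.2.2.2|)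

lemma auxE_pos (lam : ℝ) (p : ℝ × ℝ × ℝ × ℝ) : 0 < auxE lam p := by
  unfold auxE; positivity

lemma auxE_cont (lam : ℝ) : Continuous (auxE lam) := by
  unfold auxE; fun_prop

lemma auxF_cont (A B C : ℝ × ℝ → V →L[ℝ] V) (hA : Continuous A) (hB : Continuous B)
    (hC : Continuous C) (g : ℝ × ℝ × ℝ × ℝ → V × V × V) (hg : Continuous g) :
    Continuous (auxF A B C g) := by
  unfold auxF; fun_prop

lemma auxL_cont (A B C : ℝ × ℝ → V →L[ℝ] V) (hA : Continuous A) (hB : Continuous B)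
    (hC : Continuous C) (g : ℝ × ℝ × ℝ × ℝ → V × V × V) (hg : Continuous g) :
    Continuous (auxL A B C g) := by
  have hF := auxF_cont A B C hA hB hC g hg
  have h1 : Continuous fun p : ℝ × ℝ × ℝ × ℝ =>
      ∫ x in p.2.2.1..p.1, (g (x, p.2.2.2, p.2.2.1, p.2.2.2)).2.1 :=
    aux_cont_param _ (by fun_prop) _ _ (by fun_prop) (by fun_prop)
  have h2 : Continuous fun p : ℝ × ℝ × ℝ × ℝ =>
      ∫ x in p.2.2.2..p.2.1, (g (p.1, x, p.2.2.1, p.2.2.2)).2.2 :=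
    aux_cont_param _ (by fun_prop) _ _ (by fun_prop) (by fun_prop)
  have h3 : Continuous fun p : ℝ × ℝ × ℝ × ℝ =>
      ∫ x in p.2.2.2..p.2.1, auxF A B C g (p.1, x, p.2.2.1, p.2.2.2) :=
    aux_cont_param _ (by fun_prop) _ _ (by fun_prop) (by fun_prop)
  have h4 : Continuous fun p : ℝ × ℝ × ℝ × ℝ =>
      ∫ x in p.2.2.2..p.2.1, (g (p.2.2.1, x, p.2.2.1, p.2.2.2)).2.2 :=
    aux_cont_param _ (by fun_prop) _ _ (by fun_prop) (by fun_prop)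
  have h5 : Continuous fun p : ℝ × ℝ × ℝ × ℝ =>
      ∫ x in p.2.2.1..p.1, auxF A B C g (x, p.2.1, p.2.2.1, p.2.2.2) :=
    aux_cont_param _ (by fun_prop) _ _ (by fun_prop) (by fun_prop)
  unfold auxL
  fun_prop

lemma auxL_sub (A B C : ℝ × ℝ → V →L[ℝ] V) (hA : Continuous A) (hB : Continuous B)
    (hC : Continuous C) (g h : ℝ × ℝ × ℝ × ℝ → V × V × V) (hg : Continuous g)
    (hh : Continuous h) (p : ℝ × ℝ × ℝ × ℝ) :
    auxL A B C (g - h) p = auxL A B C g p - auxL A B C h p := by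
  have hF := auxF_cont A B C hA hB hC g hg
  have hF' := auxF_cont A B C hA hB hC h hh
  have e : auxF A B C (g - h) = fun x => auxF A B C g x - auxF A B C h x := by
    funext x; simp only [auxF, Pi.sub_apply, Prod.fst_sub, Prod.snd_sub, map_sub]; abel
  unfold auxL
  simp only [e, Pi.sub_apply, Prod.snd_sub, Prod.fst_sub]
  rw [intervalIntegral.integral_sub (Continuous.intervalIntegrable (by fun_prop) _ _)
      (Continuous.intervalIntegrable (by fun_prop) _ _),
    intervalIntegral.integral_sub (Continuous.intervalIntegrable (by fun_prop) _ _)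
      (Continuous.intervalIntegrable (by fun_prop) _ _),
    intervalIntegral.integral_sub (Continuous.intervalIntegrable (by fun_prop) _ _)
      (Continuous.intervalIntegrable (by fun_prop) _ _),
    intervalIntegral.integral_sub (Continuous.intervalIntegrable (by fun_prop) _ _)
      (Continuous.intervalIntegrable (by fun_prop) _ _),
    intervalIntegral.integral_sub (Continuous.intervalIntegrable (by fun_prop) _ _)
      (Continuous.intervalIntegrable (by fun_prop) _ _)]
  simp only [map_sub, Prod.mk_sub_mk]
  congr 1
  · abel
  · congr 1 <;> abel

lemma auxL_bound (A B C : ℝ × ℝ → V →L[ℝ] V) (K : ℝ) (hK : 0 ≤ K) (hA : ∀ p, ‖A p‖ ≤ K)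
    (hB : ∀ p, ‖B p‖ ≤ K) (hC : ∀ p, ‖C p‖ ≤ K)
    (g : ℝ × ℝ × ℝ × ℝ → V × V × V) (M : ℝ) (hM : 0 ≤ M)
    (hg : ∀ p, ‖g p‖ ≤ M * auxE (8 * K + 8) p) (p : ℝ × ℝ × ℝ × ℝ) :
    ‖auxL A B C g p‖ ≤ M / 2 * auxE (8 * K + 8) p := by
  obtain ⟨s, t, σ, τ⟩ := p
  set lam := 8 * K + 8 with hlam
  have hlam0 : 0 < lam := by positivity
  have c1 : ∀ q, ‖(g q).1‖ ≤ M * auxE lam q := fun q => (norm_fst_le (g q)).trans (hg q)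
  have c2 : ∀ q, ‖(g q).2.1‖ ≤ M * auxE lam q := fun q =>
    ((norm_fst_le (g q).2).trans (norm_snd_le (g q))).trans (hg q)
  have c3 : ∀ q, ‖(g q).2.2‖ ≤ M * auxE lam q := fun q =>
    ((norm_snd_le (g q).2).trans (norm_snd_le (g q))).trans (hg q)
  have cF : ∀ q, ‖auxF A B C g q‖ ≤ (3 * K * M) * auxE lam q := by
    intro q
    unfold auxF
    have hE := auxE_pos lam q
    refine (norm_add₃_le).trans ?_
    have d1 := (A (q.1, q.2.1)).le_of_opNorm_le_of_le (hA _) (c1 q)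
    have d2 := (B (q.1, q.2.1)).le_of_opNorm_le_of_le (hB _) (c2 q)
    have d3 := (C (q.1, q.2.1)).le_of_opNorm_le_of_le (hC _) (c3 q)
    linarith
  have one_le : ∀ x : ℝ, 1 ≤ Real.exp (lam * |x|) := fun x => Real.one_le_exp (by positivity)
  -- generic integral bounds
  have I1 : ∀ (f : ℝ × ℝ × ℝ × ℝ → V) (N : ℝ), 0 ≤ N → (∀ q, ‖f q‖ ≤ N * auxE lam q) → ∀ t',
      |t' - τ| ≤ |t - τ| →
      ‖∫ x in σ..s, f (x, t', σ, τ)‖ ≤ N * auxE lam (s, t, σ, τ) / lam := by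
    intro f N hN hf t' ht'
    have := aux_exp_bound (fun x => f (x, t', σ, τ)) σ s lam (N * Real.exp (lam * |t' - τ|)) hlam0
      (by positivity) (by
        intro x _
        refine (hf _).trans (le_of_eq ?_)
        simp only [auxE]; ring)
    refine this.trans ?_
    simp only [auxE]
    rw [mul_assoc, mul_comm (Real.exp (lam * |t' - τ|))]
    gcongr
  have I2 : ∀ (f : ℝ × ℝ × ℝ × ℝ → V) (N : ℝ), 0 ≤ N → (∀ q, ‖f q‖ ≤ N * auxE lam q) → ∀ s',
      |s' - σ| ≤ |s - σ| →
      ‖∫ x in τ..t, f (s', x, σ, τ)‖ ≤ N * auxE lam (s, t, σ, τ) / lam := by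
    intro f N hN hf s' hs'
    have := aux_exp_bound (fun x => f (s', x, σ, τ)) τ t lam (N * Real.exp (lam * |s' - σ|)) hlam0
      (by positivity) (by
        intro x _
        refine (hf _).trans (le_of_eq ?_)
        simp only [auxE]; ring)
    refine this.trans ?_
    simp only [auxE]
    rw [mul_assoc]
    gcongr
  have hE := auxE_pos lam (s, t, σ, τ)
  set E := auxE lam (s, t, σ, τ) with hEdef
  have b1 := I1 (fun q => (g q).2.1) M hM c2 τ (by simp)
  have b2 := I2 (fun q => (g q).2.2) M hM c3 s le_rfl
  have b3 := I2 (auxF A B C g) (3 * K * M) (by positivity) cF s le_rfl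
  have b4 := I2 (fun q => (g q).2.2) M hM c3 σ (by simp)
  have b5 := I1 (auxF A B C g) (3 * K * M) (by positivity) cF t le_rfl
  have hME : 0 ≤ M * E := by positivity
  have f1 : M * E / lam + M * E / lam ≤ M / 2 * E := by
    rw [← add_div, div_le_iff₀ hlam0]
    have : 0 ≤ K * (M * E) := by positivity
    rw [hlam]; linarith
  have f2 : K * (M * E / lam) + 3 * K * M * E / lam ≤ M / 2 * E := by
    rw [← mul_div_assoc, ← add_div, div_le_iff₀ hlam0]
    rw [hlam]; linarith
  unfold auxL
  simp only [Prod.norm_mk]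
  refine max_le ?_ (max_le ?_ ?_)
  · exact (norm_add_le _ _).trans ((add_le_add b1 b2).trans f1)
  · exact (norm_add_le _ _).trans ((add_le_add
      ((C (s, τ)).le_of_opNorm_le_of_le (hC _) b1) b3).trans f2)
  · exact (norm_add_le _ _).trans ((add_le_add
      ((B (σ, t)).le_of_opNorm_le_of_le (hB _) b4) b5).trans f2)

/-- Existence of a jointly continuous solution of the Volterra equation. -/
lemma aux_exists_volterra [CompleteSpace V] (A B C : ℝ × ℝ → V →L[ℝ] V) (hA : Continuous A)
    (hB : Continuous B) (hC : Continuous C) (w : ℝ × ℝ → V) (hw : Continuous w)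
    (K : ℝ) (hA' : ∀ p, ‖A p‖ ≤ K) (hB' : ∀ p, ‖B p‖ ≤ K) (hC' : ∀ p, ‖C p‖ ≤ K)
    (hw' : ∀ p, ‖w p‖ ≤ K) :
    ∃ g : ℝ × ℝ × ℝ × ℝ → V × V × V, Continuous g ∧
      ∀ p, g p = auxG B C w p + auxL A B C g p := by
  have hK : 0 ≤ K := (norm_nonneg _).trans (hA' 0)
  have hGc : Continuous (auxG B C w) := by unfold auxG; fun_prop
  have hGb : ∀ p, ‖auxG B C w p‖ ≤ K + K * K := by
    intro p
    have hKK : 0 ≤ K * K := by positivity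
    unfold auxG
    simp only [Prod.norm_mk]
    refine max_le ((hw' _).trans (by linarith)) (max_le ?_ ?_)
    · exact ((C _).le_of_opNorm_le_of_le (hC' _) (hw' _)).trans (by linarith)
    · exact ((B _).le_of_opNorm_le_of_le (hB' _) (hw' _)).trans (by linarith)
  set lam := 8 * K + 8 with hlam
  have hlam0 : 0 < lam := by positivity
  have hEc := auxE_cont lam
  have hE1 : ∀ p, 1 ≤ auxE lam p := by
    intro p
    unfold auxE
    exact one_le_mul_of_one_le_of_one_le (Real.one_le_exp (by positivity))
      (Real.one_le_exp (by positivity))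
  have hEi : Continuous fun p => (auxE lam p)⁻¹ := hEc.inv₀ fun p => (auxE_pos lam p).ne'
  let S : (BoundedContinuousFunction (ℝ × ℝ × ℝ × ℝ) (V × V × V)) → ℝ × ℝ × ℝ × ℝ → V × V × V :=
    fun f p => auxE lam p • f p
  have hSc : ∀ f, Continuous (S f) := fun f => hEc.smul f.continuous
  have hLb : ∀ (f : ℝ × ℝ × ℝ × ℝ → V × V × V) (M : ℝ), 0 ≤ M →
      (∀ p, ‖f p‖ ≤ M * auxE lam p) → ∀ p,
      ‖(auxE lam p)⁻¹ • auxL A B C f p‖ ≤ M / 2 := by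
    intro f M hM hf p
    have h := auxL_bound A B C K hK hA' hB' hC' f M hM hf p
    have hE := auxE_pos lam p
    rw [norm_smul, norm_inv, Real.norm_of_nonneg hE.le, inv_mul_le_iff₀ hE]
    linarith
  have hSb : ∀ f p, ‖S f p‖ ≤ ‖f‖ * auxE lam p := by
    intro f p
    have hE := auxE_pos lam p
    simp only [S]
    rw [norm_smul, Real.norm_of_nonneg hE.le, mul_comm]
    gcongr
    exact f.norm_coe_le_norm p
  let T : (BoundedContinuousFunction (ℝ × ℝ × ℝ × ℝ) (V × V × V)) →
      (BoundedContinuousFunction (ℝ × ℝ × ℝ × ℝ) (V × V × V)) := fun f =>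
    BoundedContinuousFunction.ofNormedAddCommGroup
      (fun p => (auxE lam p)⁻¹ • (auxG B C w p + auxL A B C (S f) p))
      (hEi.smul (hGc.add (auxL_cont A B C hA hB hC _ (hSc f))))
      (K + K * K + ‖f‖ / 2) (by
        intro p
        rw [smul_add]
        refine (norm_add_le _ _).trans (add_le_add ?_ (hLb _ _ (norm_nonneg f) (hSb f) p))
        have hE := auxE_pos lam p
        rw [norm_smul, norm_inv, Real.norm_of_nonneg hE.le, inv_mul_le_iff₀ hE]
        refine (hGb p).trans ?_
        have : 0 ≤ K + K * K := by positivity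
        nlinarith [hE1 p])
  have hT : ContractingWith (1/2) T := by
    refine ⟨by rw [div_lt_one] <;> norm_num, LipschitzWith.of_dist_le_mul fun f g => ?_⟩
    rw [BoundedContinuousFunction.dist_le (by positivity)]
    intro p
    rw [dist_eq_norm, dist_eq_norm]
    have e : T f p - T g p = (auxE lam p)⁻¹ • auxL A B C (S f - S g) p := by
      rw [auxL_sub A B C hA hB hC _ _ (hSc f) (hSc g)]
      change (auxE lam p)⁻¹ • (auxG B C w p + auxL A B C (S f) p) -
        (auxE lam p)⁻¹ • (auxG B C w p + auxL A B C (S g) p) = _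
      rw [← smul_sub, add_sub_add_left_eq_sub]
    rw [e]
    have := hLb (S f - S g) ‖f - g‖ (norm_nonneg _) (by
      intro p
      have h := hSb (f - g) p
      have e2 : S (f - g) p = (S f - S g) p := by
        simp [S, smul_sub]
      rwa [e2] at h) p
    refine this.trans (le_of_eq ?_)
    push_cast
    ring
  obtain ⟨f, hf⟩ : ∃ f, T f = f := ⟨_, hT.fixedPoint_isFixedPt⟩
  refine ⟨S f, hSc f, fun p => ?_⟩
  have : f p = (auxE lam p)⁻¹ • (auxG B C w p + auxL A B C (S f) p) := by
    conv_lhs => rw [← hf]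
    rfl
  conv_lhs => simp only [S]
  rw [this, smul_smul, mul_inv_cancel₀ (auxE_pos lam p).ne', one_smul]

/-- The vector-valued Riemann function (applied to `w`), jointly continuous. -/
lemma aux_riemann [CompleteSpace V] (A B C : ℝ × ℝ → V →L[ℝ] V) (hA : Continuous A)
    (hB : Continuous B) (hC : Continuous C) (w : ℝ × ℝ → V) (hw : Continuous w)
    (K : ℝ) (hA' : ∀ p, ‖A p‖ ≤ K) (hB' : ∀ p, ‖B p‖ ≤ K) (hC' : ∀ p, ‖C p‖ ≤ K)
    (hw' : ∀ p, ‖w p‖ ≤ K) :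
    ∃ r v u F : ℝ × ℝ × ℝ × ℝ → V, Continuous r ∧ Continuous v ∧ Continuous u ∧ Continuous F ∧
      (∀ s t σ τ, F (s, t, σ, τ) = A (s, t) (r (s, t, σ, τ)) + B (s, t) (v (s, t, σ, τ)) +
        C (s, t) (u (s, t, σ, τ))) ∧
      (∀ σ τ, r (σ, τ, σ, τ) = w (σ, τ)) ∧
      (∀ s σ τ, v (s, τ, σ, τ) = C (s, τ) (r (s, τ, σ, τ))) ∧
      (∀ t σ τ, u (σ, t, σ, τ) = B (σ, t) (r (σ, t, σ, τ))) ∧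
      (∀ s t σ τ, r (s, t, σ, τ) = r (σ, t, σ, τ) + ∫ x in σ..s, v (x, t, σ, τ)) ∧
      (∀ s t σ τ, r (s, t, σ, τ) = r (s, τ, σ, τ) + ∫ x in τ..t, u (s, x, σ, τ)) ∧
      (∀ s t σ τ, v (s, t, σ, τ) = v (s, τ, σ, τ) + ∫ x in τ..t, F (s, x, σ, τ)) := by
  obtain ⟨g, hg, heq⟩ := aux_exists_volterra A B C hA hB hC w hw K hA' hB' hC' hw'
  have hF := auxF_cont A B C hA hB hC g hg
  set F := auxF A B C g with hFdef
  have e1 : ∀ s t σ τ, (g (s, t, σ, τ)).1 = w (σ, τ) +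
      ((∫ x in σ..s, (g (x, τ, σ, τ)).2.1) + ∫ x in τ..t, (g (s, x, σ, τ)).2.2) := by
    intro s t σ τ
    conv_lhs => rw [heq]
    rfl
  have e2 : ∀ s t σ τ, (g (s, t, σ, τ)).2.1 = C (s, τ) (w (σ, τ)) +
      (C (s, τ) (∫ x in σ..s, (g (x, τ, σ, τ)).2.1) + ∫ x in τ..t, F (s, x, σ, τ)) := by
    intro s t σ τ
    conv_lhs => rw [heq]
    rfl
  have e3 : ∀ s t σ τ, (g (s, t, σ, τ)).2.2 = B (σ, t) (w (σ, τ)) +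
      (B (σ, t) (∫ x in τ..t, (g (σ, x, σ, τ)).2.2) + ∫ x in σ..s, F (x, t, σ, τ)) := by
    intro s t σ τ
    conv_lhs => rw [heq]
    rfl
  have k1 : ∀ s σ τ, (g (s, τ, σ, τ)).2.1 = C (s, τ) (g (s, τ, σ, τ)).1 := by
    intro s σ τ
    rw [e1, e2]; simp
  have k2 : ∀ t σ τ, (g (σ, t, σ, τ)).2.2 = B (σ, t) (g (σ, t, σ, τ)).1 := by
    intro t σ τ
    rw [e1, e3]; simp
  have k3 : ∀ s t σ τ, (g (s, t, σ, τ)).1 = (g (s, τ, σ, τ)).1 +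
      ∫ x in τ..t, (g (s, x, σ, τ)).2.2 := by
    intro s t σ τ
    rw [e1, e1 s τ]; simp [add_assoc]
  have k4 : ∀ s t σ τ, (g (s, t, σ, τ)).2.1 = (g (s, τ, σ, τ)).2.1 +
      ∫ x in τ..t, F (s, x, σ, τ) := by
    intro s t σ τ
    rw [e2, e2 s τ]; simp [add_assoc]
  have k5 : ∀ s t σ τ, (g (s, t, σ, τ)).2.2 = (g (σ, t, σ, τ)).2.2 +
      ∫ x in σ..s, F (x, t, σ, τ) := by
    intro s t σ τ
    rw [e3, e3 σ t]; simp [add_assoc]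
  refine ⟨fun p => (g p).1, fun p => (g p).2.1, fun p => (g p).2.2, F, by fun_prop, by fun_prop,
    by fun_prop, hF, fun _ _ _ _ => rfl, ?_, k1, k2, ?_, k3, k4⟩
  · intro σ τ
    simp [e1]
  · intro s t σ τ
    simp only
    have c1 : Continuous fun x => ∫ y in σ..s, F (y, x, σ, τ) :=
      aux_cont_param _ (by fun_prop) _ _ (by fun_prop) (by fun_prop)
    have c2 : Continuous fun x => ∫ y in τ..t, F (x, y, σ, τ) :=
      aux_cont_param _ (by fun_prop) _ _ (by fun_prop) (by fun_prop)
    have i1 : (∫ x in τ..t, (g (s, x, σ, τ)).2.2) =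
        (∫ x in τ..t, (g (σ, x, σ, τ)).2.2) + ∫ x in τ..t, ∫ y in σ..s, F (y, x, σ, τ) := by
      rw [← intervalIntegral.integral_add (Continuous.intervalIntegrable (by fun_prop) _ _)
        (c1.intervalIntegrable _ _)]
      exact intervalIntegral.integral_congr fun x _ => k5 s x σ τ
    have i2 : (∫ x in σ..s, (g (x, t, σ, τ)).2.1) =
        (∫ x in σ..s, (g (x, τ, σ, τ)).2.1) + ∫ x in σ..s, ∫ y in τ..t, F (x, y, σ, τ) := by
      rw [← intervalIntegral.integral_add (Continuous.intervalIntegrable (by fun_prop) _ _)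
        (c2.intervalIntegrable _ _)]
      exact intervalIntegral.integral_congr fun x _ => k4 x t σ τ
    rw [e1 s t, e1 σ t, i1, i2, aux_swap (fun x y => F (x, y, σ, τ)) (by fun_prop)]
    simp only [intervalIntegral.integral_same]
    abel

/-- The superposition integral solves the inhomogeneous problem. -/
lemma aux_superposition [CompleteSpace V] (A B C : ℝ × ℝ → V →L[ℝ] V) (hA : Continuous A)
    (hB : Continuous B) (hC : Continuous C) (w : ℝ × ℝ → V) (hw : Continuous w)
    (r v u F : ℝ × ℝ × ℝ × ℝ → V) (hr : Continuous r) (hv : Continuous v) (hu : Continuous u)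
    (hF : Continuous F)
    (eF : ∀ s t σ τ, F (s, t, σ, τ) = A (s, t) (r (s, t, σ, τ)) + B (s, t) (v (s, t, σ, τ)) +
        C (s, t) (u (s, t, σ, τ)))
    (e0 : ∀ σ τ, r (σ, τ, σ, τ) = w (σ, τ))
    (eC : ∀ s σ τ, v (s, τ, σ, τ) = C (s, τ) (r (s, τ, σ, τ)))
    (eB : ∀ t σ τ, u (σ, t, σ, τ) = B (σ, t) (r (σ, t, σ, τ)))
    (es : ∀ s t σ τ, r (s, t, σ, τ) = r (σ, t, σ, τ) + ∫ x in σ..s, v (x, t, σ, τ))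
    (et : ∀ s t σ τ, r (s, t, σ, τ) = r (s, τ, σ, τ) + ∫ x in τ..t, u (s, x, σ, τ))
    (est : ∀ s t σ τ, v (s, t, σ, τ) = v (s, τ, σ, τ) + ∫ x in τ..t, F (s, x, σ, τ))
    (y : ℝ × ℝ → V)
    (hy : ∀ p : ℝ × ℝ, y p = ∫ σ in (0:ℝ)..p.1, ∫ τ in (0:ℝ)..p.2, r (p.1, p.2, σ, τ)) :
    ∃ ys yt yst : ℝ × ℝ → V, Continuous y ∧ Continuous ys ∧ Continuous yt ∧ Continuous yst ∧
      ∀ p : ℝ × ℝ, HasDerivAt (fun s => y (s, p.2)) (ys p) p.1 ∧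
        HasDerivAt (fun t => y (p.1, t)) (yt p) p.2 ∧
        HasDerivAt (fun t => ys (p.1, t)) (yst p) p.2 ∧
        yst p = A p (y p) + B p (ys p) + C p (yt p) + w p := by
  have cI : ∀ f : ℝ × ℝ × ℝ × ℝ → V, Continuous f →
      Continuous fun q : ℝ × ℝ × ℝ × ℝ => ∫ τ in (0:ℝ)..q.2.2.1, f (q.1, q.2.1, q.2.2.2, τ) :=
    fun f hf => aux_cont_param _ (by fun_prop) _ _ (by fun_prop) (by fun_prop)
  have cI' : ∀ f : ℝ × ℝ × ℝ × ℝ → V, Continuous f →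
      Continuous fun q : ℝ × ℝ × ℝ × ℝ => ∫ σ in (0:ℝ)..q.2.2.1, f (q.1, q.2.1, σ, q.2.2.2) :=
    fun f hf => aux_cont_param _ (by fun_prop) _ _ (by fun_prop) (by fun_prop)
  have c1 : ∀ f : ℝ × ℝ × ℝ × ℝ → V, Continuous f →
      Continuous fun p : ℝ × ℝ => ∫ τ in (0:ℝ)..p.2, f (p.1, p.2, p.1, τ) :=
    fun f hf => aux_cont_param _ (by fun_prop) _ _ (by fun_prop) (by fun_prop)
  have c2 : ∀ f : ℝ × ℝ × ℝ × ℝ → V, Continuous f →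
      Continuous fun p : ℝ × ℝ => ∫ σ in (0:ℝ)..p.1, f (p.1, p.2, σ, p.2) :=
    fun f hf => aux_cont_param _ (by fun_prop) _ _ (by fun_prop) (by fun_prop)
  have c3 : ∀ f : ℝ × ℝ × ℝ × ℝ → V, Continuous f →
      Continuous fun p : ℝ × ℝ =>
        ∫ σ in (0:ℝ)..p.1, ∫ τ in (0:ℝ)..p.2, f (p.1, p.2, σ, τ) :=
    fun f hf => aux_cont_param _ ((cI f hf).comp (by fun_prop :
      Continuous fun p : (ℝ × ℝ) × ℝ => (p.1.1, p.1.2, p.1.2, p.2))) _ _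
      (by fun_prop) (by fun_prop)
  have sw : ∀ f : ℝ × ℝ × ℝ × ℝ → V, Continuous f → ∀ s t,
      ∫ σ in (0:ℝ)..s, ∫ τ in (0:ℝ)..t, f (s, t, σ, τ) =
      ∫ τ in (0:ℝ)..t, ∫ σ in (0:ℝ)..s, f (s, t, σ, τ) := fun f hf s t =>
    aux_swap (fun σ τ => f (s, t, σ, τ)) (by fun_prop) _ _ _ _
  -- derivative in `t` of a double integral
  have Dt : ∀ f f' : ℝ × ℝ × ℝ × ℝ → V, Continuous f → Continuous f' →
      (∀ s t σ τ, f (s, t, σ, τ) = f (s, τ, σ, τ) + ∫ x in τ..t, f' (s, x, σ, τ)) → ∀ s t,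
      HasDerivAt (fun t => ∫ σ in (0:ℝ)..s, ∫ τ in (0:ℝ)..t, f (s, t, σ, τ))
        ((∫ σ in (0:ℝ)..s, f (s, t, σ, t)) +
          ∫ σ in (0:ℝ)..s, ∫ τ in (0:ℝ)..t, f' (s, t, σ, τ)) t := by
    intro f f' hf hf' h s t
    have hL := aux_leibniz (fun τ => ∫ σ in (0:ℝ)..s, f (s, τ, σ, τ))
      ((cI' f hf).comp (by fun_prop : Continuous fun τ : ℝ => (s, τ, s, τ)))
      (fun x τ => ∫ σ in (0:ℝ)..s, f' (s, x, σ, τ))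
      ((cI' f' hf').comp (by fun_prop : Continuous fun p : ℝ × ℝ => (s, p.1, s, p.2))) t
    rw [sw f' hf']
    convert hL using 1
    funext t
    rw [sw f hf]
    apply intervalIntegral.integral_congr
    intro τ _
    simp only
    rw [← aux_swap (fun σ x => f' (s, x, σ, τ)) (by fun_prop)]
    have cc : Continuous fun σ => ∫ x in τ..t, f' (s, x, σ, τ) :=
      aux_cont_param _ (by fun_prop) _ _ (by fun_prop) (by fun_prop)
    rw [← intervalIntegral.integral_add (Continuous.intervalIntegrable (by fun_prop) _ _)
      (cc.intervalIntegrable _ _)]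
    exact intervalIntegral.integral_congr fun σ _ => h s t σ τ
  have Ds : ∀ s t,
      HasDerivAt (fun s => ∫ σ in (0:ℝ)..s, ∫ τ in (0:ℝ)..t, r (s, t, σ, τ))
        ((∫ τ in (0:ℝ)..t, r (s, t, s, τ)) +
          ∫ σ in (0:ℝ)..s, ∫ τ in (0:ℝ)..t, v (s, t, σ, τ)) s := by
    intro s t
    have hL := aux_leibniz (fun σ => ∫ τ in (0:ℝ)..t, r (σ, t, σ, τ))
      ((cI r hr).comp (by fun_prop : Continuous fun σ : ℝ => (σ, t, t, σ)))
      (fun x σ => ∫ τ in (0:ℝ)..t, v (x, t, σ, τ))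
      ((cI v hv).comp (by fun_prop : Continuous fun p : ℝ × ℝ => (p.1, t, t, p.2))) s
    convert hL using 1
    funext s
    apply intervalIntegral.integral_congr
    intro σ _
    simp only
    rw [← aux_swap (fun τ x => v (x, t, σ, τ)) (by fun_prop)]
    have cc : Continuous fun τ => ∫ x in σ..s, v (x, t, σ, τ) :=
      aux_cont_param _ (by fun_prop) _ _ (by fun_prop) (by fun_prop)
    rw [← intervalIntegral.integral_add (Continuous.intervalIntegrable (by fun_prop) _ _)
      (cc.intervalIntegrable _ _)]
    exact intervalIntegral.integral_congr fun τ _ => es s t σ τ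
  have hy' : y = fun p : ℝ × ℝ =>
      ∫ σ in (0:ℝ)..p.1, ∫ τ in (0:ℝ)..p.2, r (p.1, p.2, σ, τ) := funext hy
  have hyc : Continuous y := by rw [hy']; exact c3 r hr
  let ys : ℝ × ℝ → V := fun p => (∫ τ in (0:ℝ)..p.2, r (p.1, p.2, p.1, τ)) +
    ∫ σ in (0:ℝ)..p.1, ∫ τ in (0:ℝ)..p.2, v (p.1, p.2, σ, τ)
  let yt : ℝ × ℝ → V := fun p => (∫ σ in (0:ℝ)..p.1, r (p.1, p.2, σ, p.2)) +
    ∫ σ in (0:ℝ)..p.1, ∫ τ in (0:ℝ)..p.2, u (p.1, p.2, σ, τ)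
  have hysc : Continuous ys := (c1 r hr).add (c3 v hv)
  have hytc : Continuous yt := (c2 r hr).add (c3 u hu)
  refine ⟨ys, yt, fun p => A p (y p) + B p (ys p) + C p (yt p) + w p, hyc, hysc, hytc,
    by fun_prop, ?_⟩
  rintro ⟨s, t⟩
  refine ⟨?_, ?_, ?_, rfl⟩
  · rw [hy']; exact Ds s t
  · rw [hy']; exact Dt r u hr hu et s t
  · have d1 : HasDerivAt (fun t => ∫ τ in (0:ℝ)..t, r (s, t, s, τ))
        (w (s, t) + ∫ τ in (0:ℝ)..t, u (s, t, s, τ)) t := by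
      have hL := aux_leibniz (fun τ => r (s, τ, s, τ)) (by fun_prop)
        (fun x τ => u (s, x, s, τ)) (by fun_prop) t
      rw [e0] at hL
      convert hL using 1
      funext t
      exact intervalIntegral.integral_congr fun τ _ => et s t s τ
    have d2 := d1.add (Dt v F hv hF est s t)
    refine HasDerivAt.congr_deriv (f' := _) d2 ?_
    have ii : ∀ f : ℝ × ℝ × ℝ × ℝ → V, Continuous f →
        Continuous fun σ => ∫ τ in (0:ℝ)..t, f (s, t, σ, τ) := fun f hf =>
      (cI f hf).comp (by fun_prop : Continuous fun σ : ℝ => (s, t, t, σ))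
    have j1 : ∫ τ in (0:ℝ)..t, u (s, t, s, τ) = B (s, t) (∫ τ in (0:ℝ)..t, r (s, t, s, τ)) := by
      rw [← ContinuousLinearMap.intervalIntegral_comp_comm _
        (Continuous.intervalIntegrable (by fun_prop) _ _)]
      exact intervalIntegral.integral_congr fun τ _ => eB t s τ
    have j2 : ∫ σ in (0:ℝ)..s, v (s, t, σ, t) = C (s, t) (∫ σ in (0:ℝ)..s, r (s, t, σ, t)) := by
      rw [← ContinuousLinearMap.intervalIntegral_comp_comm _
        (Continuous.intervalIntegrable (by fun_prop) _ _)]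
      exact intervalIntegral.integral_congr fun σ _ => eC s σ t
    have jf : ∀ (L : V →L[ℝ] V) (f : ℝ × ℝ × ℝ × ℝ → V), Continuous f →
        L (∫ σ in (0:ℝ)..s, ∫ τ in (0:ℝ)..t, f (s, t, σ, τ)) =
        ∫ σ in (0:ℝ)..s, ∫ τ in (0:ℝ)..t, L (f (s, t, σ, τ)) := by
      intro L f hf
      rw [← ContinuousLinearMap.intervalIntegral_comp_comm _ ((ii f hf).intervalIntegrable _ _)]
      refine intervalIntegral.integral_congr fun σ _ => ?_
      exact (ContinuousLinearMap.intervalIntegral_comp_comm _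
        (Continuous.intervalIntegrable (by fun_prop) _ _)).symm
    have j3 : ∫ σ in (0:ℝ)..s, ∫ τ in (0:ℝ)..t, F (s, t, σ, τ) =
        A (s, t) (∫ σ in (0:ℝ)..s, ∫ τ in (0:ℝ)..t, r (s, t, σ, τ)) +
        B (s, t) (∫ σ in (0:ℝ)..s, ∫ τ in (0:ℝ)..t, v (s, t, σ, τ)) +
        C (s, t) (∫ σ in (0:ℝ)..s, ∫ τ in (0:ℝ)..t, u (s, t, σ, τ)) := by
      rw [jf _ r hr, jf _ v hv, jf _ u hu]
      have m1 := ii (fun p => A (s, t) (r p)) (by fun_prop)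
      have m2 := ii (fun p => B (s, t) (v p)) (by fun_prop)
      have m3 := ii (fun p => C (s, t) (u p)) (by fun_prop)
      have m12 : Continuous fun σ => (∫ τ in (0:ℝ)..t, A (s, t) (r (s, t, σ, τ))) +
          ∫ τ in (0:ℝ)..t, B (s, t) (v (s, t, σ, τ)) := m1.add m2
      rw [← intervalIntegral.integral_add (m1.intervalIntegrable _ _) (m2.intervalIntegrable _ _),
        ← intervalIntegral.integral_add (m12.intervalIntegrable _ _)
          (m3.intervalIntegrable _ _)]
      refine intervalIntegral.integral_congr fun σ _ => ?_
      rw [← intervalIntegral.integral_add (Continuous.intervalIntegrable (by fun_prop) _ _)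
          (Continuous.intervalIntegrable (by fun_prop) _ _),
        ← intervalIntegral.integral_add (Continuous.intervalIntegrable (by fun_prop) _ _)
          (Continuous.intervalIntegrable (by fun_prop) _ _)]
      exact intervalIntegral.integral_congr fun τ _ => eF s t σ τ
    rw [j1, j2, j3]
    simp only [hy, ys, yt, map_add]
    abel

lemma aux_ftc [CompleteSpace V] (c d : ℝ) (f g : ℝ → V) (hg : Continuous g)
    (h : ∀ t ∈ Icc c d, HasDerivWithinAt f (g t) (Icc c d) t) (t : ℝ) (ht : t ∈ Icc c d) :
    f t = f c + ∫ x in c..t, g x := by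
  have hc : ContinuousOn f (Icc c d) := fun x hx => (h x hx).continuousWithinAt
  rw [intervalIntegral.integral_eq_sub_of_hasDerivAt_of_le ht.1
    (hc.mono (Icc_subset_Icc_right ht.2)) (fun x hx => ?_) (hg.intervalIntegrable _ _)]
  · abel
  · have hx' : x ∈ Ioo c d := ⟨hx.1, hx.2.trans_le ht.2⟩
    exact (h x ⟨hx'.1.le, hx'.2.le⟩).hasDerivAt (Icc_mem_nhds hx'.1 hx'.2)

/-- Clamping to the interval `[c, d]`. -/
noncomputable def auxCl (c d s : ℝ) : ℝ := max c (min d s)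

lemma auxCl_cont (c d : ℝ) : Continuous (auxCl c d) := by unfold auxCl; fun_prop

lemma auxCl_mem {c d : ℝ} (h : c ≤ d) (s : ℝ) : auxCl c d s ∈ Icc c d :=
  ⟨le_max_left _ _, max_le h (min_le_left _ _)⟩

lemma auxCl_eq {c d s : ℝ} (h : s ∈ Icc c d) : auxCl c d s = s := by
  unfold auxCl; rw [min_eq_right h.2, max_eq_right h.1]

lemma auxCl_abs {c d : ℝ} (h : c ≤ d) (s : ℝ) : |auxCl c d s - c| ≤ |s - c| := by
  have h1 := auxCl_mem h s
  rw [abs_of_nonneg (by linarith [h1.1])]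
  rcases le_total c s with h2 | h2
  · rw [abs_of_nonneg (by linarith)]
    have : auxCl c d s ≤ s := max_le h2 (min_le_right _ _)
    linarith
  · have : auxCl c d s = c := max_eq_left ((min_le_right _ _).trans h2)
    rw [this]; simp

/-- Uniqueness for the homogeneous Goursat problem on a rectangle. -/
lemma aux_unique [CompleteSpace V] (a0 a1 b0 b1 : ℝ) (ha : a0 < a1) (hb : b0 < b1)
    (A B C : ℝ × ℝ → V →L[ℝ] V) (K : ℝ) (hA' : ∀ p, ‖A p‖ ≤ K) (hB' : ∀ p, ‖B p‖ ≤ K)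
    (hC' : ∀ p, ‖C p‖ ≤ K)
    (x xs xt xst : ℝ × ℝ → V)
    (hx : ContinuousOn x (Icc a0 a1 ×ˢ Icc b0 b1)) (hxs : ContinuousOn xs (Icc a0 a1 ×ˢ Icc b0 b1))
    (hxt : ContinuousOn xt (Icc a0 a1 ×ˢ Icc b0 b1))
    (hxst : ContinuousOn xst (Icc a0 a1 ×ˢ Icc b0 b1))
    (hd : ∀ p ∈ Icc a0 a1 ×ˢ Icc b0 b1,
      HasDerivWithinAt (fun s => x (s, p.2)) (xs p) (Icc a0 a1) p.1 ∧
      HasDerivWithinAt (fun t => x (p.1, t)) (xt p) (Icc b0 b1) p.2 ∧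
      HasDerivWithinAt (fun t => xs (p.1, t)) (xst p) (Icc b0 b1) p.2 ∧
      xst p = A p (x p) + B p (xs p) + C p (xt p))
    (h0 : x (a0, b0) = 0)
    (hsC : ∀ s ∈ Icc a0 a1, xs (s, b0) = C (s, b0) (x (s, b0)))
    (htB : ∀ t ∈ Icc b0 b1, xt (a0, t) = B (a0, t) (x (a0, t))) :
    ∀ p ∈ Icc a0 a1 ×ˢ Icc b0 b1, x p = 0 := by
  have hK : 0 ≤ K := (norm_nonneg _).trans (hA' 0)
  let P : ℝ × ℝ → ℝ × ℝ := fun p => (auxCl a0 a1 p.1, auxCl b0 b1 p.2)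
  have hPm : ∀ p, P p ∈ Icc a0 a1 ×ˢ Icc b0 b1 := fun p => ⟨auxCl_mem ha.le _, auxCl_mem hb.le _⟩
  have hPc : Continuous P :=
    ((auxCl_cont _ _).comp continuous_fst).prodMk ((auxCl_cont _ _).comp continuous_snd)
  have hPe : ∀ s ∈ Icc a0 a1, ∀ t ∈ Icc b0 b1, P (s, t) = (s, t) := fun s hs t ht => by
    simp only [P, auxCl_eq hs, auxCl_eq ht]
  obtain ⟨X, hXc, hX⟩ : ∃ X : ℝ × ℝ → V, Continuous X ∧ ∀ p, X p = x (P p) :=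
    ⟨_, hx.comp_continuous hPc hPm, fun _ => rfl⟩
  obtain ⟨Xs, hXsc, hXs⟩ : ∃ X : ℝ × ℝ → V, Continuous X ∧ ∀ p, X p = xs (P p) :=
    ⟨_, hxs.comp_continuous hPc hPm, fun _ => rfl⟩
  obtain ⟨Xt, hXtc, hXt⟩ : ∃ X : ℝ × ℝ → V, Continuous X ∧ ∀ p, X p = xt (P p) :=
    ⟨_, hxt.comp_continuous hPc hPm, fun _ => rfl⟩
  obtain ⟨Xst, hXstc, hXst⟩ : ∃ X : ℝ × ℝ → V, Continuous X ∧ ∀ p, X p = xst (P p) :=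
    ⟨_, hxst.comp_continuous hPc hPm, fun _ => rfl⟩
  have ma : a0 ∈ Icc a0 a1 := ⟨le_rfl, ha.le⟩
  have mb : b0 ∈ Icc b0 b1 := ⟨le_rfl, hb.le⟩
  have E1 : ∀ s ∈ Icc a0 a1, ∀ t ∈ Icc b0 b1,
      x (s, t) = x (a0, t) + ∫ z in a0..s, Xs (z, t) := by
    intro s hs t ht
    refine aux_ftc a0 a1 (fun s => x (s, t)) (fun z => Xs (z, t)) (by fun_prop) ?_ s hs
    intro z hz
    have := (hd (z, t) ⟨hz, ht⟩).1
    rw [hXs, hPe z hz t ht]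
    exact this
  have E2 : ∀ s ∈ Icc a0 a1, ∀ t ∈ Icc b0 b1,
      x (s, t) = x (s, b0) + ∫ z in b0..t, Xt (s, z) := by
    intro s hs t ht
    refine aux_ftc b0 b1 (fun t => x (s, t)) (fun z => Xt (s, z)) (by fun_prop) ?_ t ht
    intro z hz
    have := (hd (s, z) ⟨hs, hz⟩).2.1
    rw [hXt, hPe s hs z hz]
    exact this
  have E3 : ∀ s ∈ Icc a0 a1, ∀ t ∈ Icc b0 b1,
      xs (s, t) = xs (s, b0) + ∫ z in b0..t, Xst (s, z) := by
    intro s hs t ht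
    refine aux_ftc b0 b1 (fun t => xs (s, t)) (fun z => Xst (s, z)) (by fun_prop) ?_ t ht
    intro z hz
    have := (hd (s, z) ⟨hs, hz⟩).2.2.1
    rw [hXst, hPe s hs z hz]
    exact this
  have E4 : ∀ s ∈ Icc a0 a1, ∀ t ∈ Icc b0 b1,
      xt (s, t) = xt (a0, t) + ∫ z in a0..s, Xst (z, t) := by
    intro s hs
    have cI : Continuous fun t => ∫ z in a0..s, Xst (z, t) :=
      aux_cont_param _ (by fun_prop) _ _ (by fun_prop) (by fun_prop)
    have cI2 : ∀ t, Continuous fun z => ∫ y in b0..t, Xst (z, y) := fun t =>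
      aux_cont_param _ (by fun_prop) _ _ (by fun_prop) (by fun_prop)
    let Φ : ℝ → V := fun t => Xt (s, t) - Xt (a0, t) - ∫ z in a0..s, Xst (z, t)
    have hΦ : Continuous Φ := by
      have h1 : Continuous fun t => Xt (s, t) - Xt (a0, t) := by fun_prop
      exact h1.sub cI
    have hz : ∀ t ∈ Icc b0 b1, ∫ z in b0..t, Φ z = 0 := by
      intro t ht
      simp only [Φ]
      rw [intervalIntegral.integral_sub (Continuous.intervalIntegrable (by fun_prop) _ _)
          (cI.intervalIntegrable _ _),
        intervalIntegral.integral_sub (Continuous.intervalIntegrable (by fun_prop) _ _)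
          (Continuous.intervalIntegrable (by fun_prop) _ _),
        ← aux_swap (fun z y => Xst (z, y)) (by fun_prop)]
      have e : ∫ z in a0..s, Xs (z, t) = (∫ z in a0..s, Xs (z, b0)) +
          ∫ z in a0..s, ∫ y in b0..t, Xst (z, y) := by
        rw [← intervalIntegral.integral_add (Continuous.intervalIntegrable (by fun_prop) _ _)
          ((cI2 t).intervalIntegrable _ _)]
        refine intervalIntegral.integral_congr fun z hz => ?_
        rw [uIcc_of_le hs.1] at hz
        have hz' : z ∈ Icc a0 a1 := ⟨hz.1, hz.2.trans hs.2⟩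
        simp only [hXs]
        rw [hPe z hz' t ht, hPe z hz' b0 mb]
        exact E3 z hz' t ht
      have f1 := E1 s hs t ht
      have f2 := E1 s hs b0 mb
      have f3 := E2 s hs t ht
      have f4 := E2 a0 ma t ht
      rw [e] at f1
      have g3 : (∫ z in b0..t, Xt (s, z)) = x (s, t) - x (s, b0) := by rw [f3]; abel
      have g4 : (∫ z in b0..t, Xt (a0, z)) = x (a0, t) - x (a0, b0) := by rw [f4]; abel
      rw [g3, g4, f1, f2]
      abel
    intro t ht
    have d1 : HasDerivWithinAt (fun t => ∫ z in b0..t, Φ z) (Φ t) (Icc b0 b1) t :=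
      (hΦ.integral_hasStrictDerivAt b0 t).hasDerivAt.hasDerivWithinAt
    have d2 : HasDerivWithinAt (fun t => ∫ z in b0..t, Φ z) 0 (Icc b0 b1) t :=
      (hasDerivWithinAt_const t (Icc b0 b1) (0 : V)).congr hz (hz t ht)
    have e := (uniqueDiffOn_Icc hb t ht).eq_deriv _ d1 d2
    simp only [Φ] at e
    rw [hXt, hXt, hPe s hs t ht, hPe a0 ma t ht, sub_sub, sub_eq_zero] at e
    exact e
  -- the weighted maximum
  let G : ℝ × ℝ → V × V × V := fun p => (X p, Xs p, Xt p)
  have hGc : Continuous G := by fun_prop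
  classical
  let g : ℝ × ℝ × ℝ × ℝ → V × V × V := fun q => if q.2.2 = (a0, b0) then G (q.1, q.2.1) else 0
  have hg : ∀ s t, g (s, t, a0, b0) = G (s, t) := fun s t => by simp [g]
  have key : ∀ s ∈ Icc a0 a1, ∀ t ∈ Icc b0 b1, G (s, t) = auxL A B C g (s, t, a0, b0) := by
    intro s hs t ht
    have hF : ∀ s ∈ Icc a0 a1, ∀ t ∈ Icc b0 b1, auxF A B C g (s, t, a0, b0) = Xst (s, t) := by
      intro s hs t ht
      simp only [auxF, hg, G, hX, hXs, hXt, hXst]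
      rw [hPe s hs t ht]
      exact ((hd (s, t) ⟨hs, ht⟩).2.2.2).symm
    have i1 : ∫ z in b0..t, auxF A B C g (s, z, a0, b0) = ∫ z in b0..t, Xst (s, z) := by
      refine intervalIntegral.integral_congr fun z hz => ?_
      rw [uIcc_of_le ht.1] at hz
      exact hF s hs z ⟨hz.1, hz.2.trans ht.2⟩
    have i2 : ∫ z in a0..s, auxF A B C g (z, t, a0, b0) = ∫ z in a0..s, Xst (z, t) := by
      refine intervalIntegral.integral_congr fun z hz => ?_
      rw [uIcc_of_le hs.1] at hz
      exact hF z ⟨hz.1, hz.2.trans hs.2⟩ t ht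
    have f1 := E1 s hs b0 mb
    have f2 := E2 a0 ma t ht
    rw [h0, zero_add] at f1 f2
    simp only [auxL, i1, i2, hg, G]
    rw [← f1, ← f2, ← hsC s hs, ← htB t ht, ← E2 s hs t ht, ← E3 s hs t ht, ← E4 s hs t ht,
      hX, hXs, hXt, hPe s hs t ht]
  set lam := 8 * K + 8 with hlam
  have hlam0 : 0 < lam := by positivity
  have hEc : Continuous fun p : ℝ × ℝ => auxE lam (p.1, p.2, a0, b0) :=
    (auxE_cont lam).comp (by fun_prop)
  obtain ⟨p0, hp0, hmax⟩ := (isCompact_Icc.prod isCompact_Icc).exists_isMaxOn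
    (⟨(a0, b0), ma, mb⟩ : (Icc a0 a1 ×ˢ Icc b0 b1).Nonempty)
    ((hGc.norm.div hEc (fun p => (auxE_pos _ _).ne')).continuousOn)
  set M := ‖G p0‖ / auxE lam (p0.1, p0.2, a0, b0) with hMdef
  have hM0 : 0 ≤ M := div_nonneg (norm_nonneg _) (auxE_pos _ _).le
  have hGP : ∀ p, G p = G (P p) := by
    intro p
    have : P (P p) = P p := hPe _ (hPm p).1 _ (hPm p).2
    simp only [G, hX, hXs, hXt, this]
  have hGb : ∀ p ∈ Icc a0 a1 ×ˢ Icc b0 b1, ‖G p‖ ≤ M * auxE lam (p.1, p.2, a0, b0) := by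
    intro p hp
    have := hmax hp
    exact (div_le_iff₀ (auxE_pos _ _)).1 this
  have hgb : ∀ q, ‖g q‖ ≤ M * auxE lam q := by
    rintro ⟨s, t, q⟩
    by_cases hq : q = (a0, b0)
    · subst hq
      rw [hg, hGP]
      refine (hGb _ (hPm _)).trans ?_
      simp only [auxE, P]
      gcongr M * (Real.exp (lam * ?_) * Real.exp (lam * ?_))
      · exact auxCl_abs ha.le s
      · exact auxCl_abs hb.le t
    · simp only [g, hq, if_false, norm_zero]
      exact mul_nonneg hM0 (auxE_pos _ _).le
  have hfin := auxL_bound A B C K hK hA' hB' hC' g M hM0 hgb (p0.1, p0.2, a0, b0)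
  rw [← key _ hp0.1 _ hp0.2, ← div_le_iff₀ (auxE_pos _ _)] at hfin
  have hM1 : M ≤ M / 2 := hfin
  have hM2 : M = 0 := by linarith
  intro p hp
  have h1 := hGb p hp
  rw [hM2, zero_mul] at h1
  have h2 : G p = 0 := norm_le_zero_iff.1 h1
  have h3 : X p = 0 := congrArg Prod.fst h2
  rw [hX, hPe _ hp.1 _ hp.2] at h3
  exact h3

end RiemannAux

attribute [local instance] Matrix.normedAddCommGroup Matrix.normedSpace

/-- The Riemann-function representation formula: given the matrix-valued
Riemann function `R(·,·,σ,τ)` of the linear Goursat–Darboux operator, the function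
`y(s,t) = ∫₀ˢ∫₀ᵗ R(s,t,σ,τ) w(σ,τ) dτ dσ` is the unique solution of the inhomogeneous
problem `∂²y/∂s∂t = A y + B y_s + C y_t + w` with zero characteristic data. -/
theorem riemann_representation_formula
    (n : ℕ) (a b : ℝ) (ha : 0 < a) (hb : 0 < b)
    (A B C : ℝ × ℝ → Matrix (Fin n) (Fin n) ℝ)
    (hA : ContinuousOn A (Icc 0 a ×ˢ Icc 0 b))
    (hB : ContinuousOn B (Icc 0 a ×ˢ Icc 0 b))
    (hC : ContinuousOn C (Icc 0 a ×ˢ Icc 0 b))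
    -- the matrix-valued Riemann function `R p q` with base point `q = (σ,τ)`,
    -- together with its partial derivatives `Rs`, `Rt`, `Rst` in `p = (s,t)`
    (R Rs Rt Rst : ℝ × ℝ → ℝ × ℝ → Matrix (Fin n) (Fin n) ℝ)
    (hRcont : ∀ q ∈ Icc (0:ℝ) a ×ˢ Icc (0:ℝ) b,
      ContinuousOn (fun p => R p q) (Icc q.1 a ×ˢ Icc q.2 b) ∧
      ContinuousOn (fun p => Rs p q) (Icc q.1 a ×ˢ Icc q.2 b) ∧
      ContinuousOn (fun p => Rt p q) (Icc q.1 a ×ˢ Icc q.2 b) ∧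
      ContinuousOn (fun p => Rst p q) (Icc q.1 a ×ˢ Icc q.2 b))
    (hRderiv : ∀ q ∈ Icc (0:ℝ) a ×ˢ Icc (0:ℝ) b, ∀ p ∈ Icc q.1 a ×ˢ Icc q.2 b,
      HasDerivWithinAt (fun s => R (s, p.2) q) (Rs p q) (Icc q.1 a) p.1 ∧
      HasDerivWithinAt (fun t => R (p.1, t) q) (Rt p q) (Icc q.2 b) p.2 ∧
      HasDerivWithinAt (fun t => Rs (p.1, t) q) (Rst p q) (Icc q.2 b) p.2)
    (hRinit : ∀ q ∈ Icc (0:ℝ) a ×ˢ Icc (0:ℝ) b,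
      R q q = 1 ∧
      (∀ s ∈ Icc q.1 a, Rs (s, q.2) q = C (s, q.2) * R (s, q.2) q) ∧
      (∀ t ∈ Icc q.2 b, Rt (q.1, t) q = B (q.1, t) * R (q.1, t) q) ∧
      (∀ p ∈ Icc q.1 a ×ˢ Icc q.2 b,
        Rst p q = A p * R p q + B p * Rs p q + C p * Rt p q))
    (w : ℝ × ℝ → Fin n → ℝ)
    (hw : ContinuousOn w (Icc 0 a ×ˢ Icc 0 b))
    (y : ℝ × ℝ → Fin n → ℝ)
    (hy : ∀ p : ℝ × ℝ, y p =
      ∫ σ in (0:ℝ)..p.1, ∫ τ in (0:ℝ)..p.2, (R p (σ, τ)).mulVec (w (σ, τ))) :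
    (∃ ys yt yst : ℝ × ℝ → Fin n → ℝ,
      ContinuousOn y (Icc 0 a ×ˢ Icc 0 b) ∧ ContinuousOn ys (Icc 0 a ×ˢ Icc 0 b) ∧
      ContinuousOn yt (Icc 0 a ×ˢ Icc 0 b) ∧ ContinuousOn yst (Icc 0 a ×ˢ Icc 0 b) ∧
      (∀ p ∈ Icc (0:ℝ) a ×ˢ Icc (0:ℝ) b,
        HasDerivWithinAt (fun s => y (s, p.2)) (ys p) (Icc 0 a) p.1 ∧
        HasDerivWithinAt (fun t => y (p.1, t)) (yt p) (Icc 0 b) p.2 ∧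
        HasDerivWithinAt (fun t => ys (p.1, t)) (yst p) (Icc 0 b) p.2 ∧
        yst p = (A p).mulVec (y p) + (B p).mulVec (ys p) + (C p).mulVec (yt p) + w p) ∧
      (∀ s ∈ Icc (0:ℝ) a, y (s, 0) = 0) ∧ (∀ t ∈ Icc (0:ℝ) b, y (0, t) = 0)) ∧
    (∀ z : ℝ × ℝ → Fin n → ℝ,
      (∃ zs zt zst : ℝ × ℝ → Fin n → ℝ,
        ContinuousOn z (Icc 0 a ×ˢ Icc 0 b) ∧ ContinuousOn zs (Icc 0 a ×ˢ Icc 0 b) ∧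
        ContinuousOn zt (Icc 0 a ×ˢ Icc 0 b) ∧ ContinuousOn zst (Icc 0 a ×ˢ Icc 0 b) ∧
        (∀ p ∈ Icc (0:ℝ) a ×ˢ Icc (0:ℝ) b,
          HasDerivWithinAt (fun s => z (s, p.2)) (zs p) (Icc 0 a) p.1 ∧
          HasDerivWithinAt (fun t => z (p.1, t)) (zt p) (Icc 0 b) p.2 ∧
          HasDerivWithinAt (fun t => zs (p.1, t)) (zst p) (Icc 0 b) p.2 ∧
          zst p = (A p).mulVec (z p) + (B p).mulVec (zs p) + (C p).mulVec (zt p) + w p) ∧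
        (∀ s ∈ Icc (0:ℝ) a, z (s, 0) = 0) ∧ (∀ t ∈ Icc (0:ℝ) b, z (0, t) = 0)) →
      Set.EqOn z y (Icc 0 a ×ˢ Icc 0 b)) := by
  let Ψ : Matrix (Fin n) (Fin n) ℝ →ₗ[ℝ] ((Fin n → ℝ) →L[ℝ] (Fin n → ℝ)) :=
    (LinearMap.toContinuousLinearMap :
      ((Fin n → ℝ) →ₗ[ℝ] (Fin n → ℝ)) ≃ₗ[ℝ] ((Fin n → ℝ) →L[ℝ] (Fin n → ℝ))).toLinearMap ∘ₗ
      (Matrix.toLin' : Matrix (Fin n) (Fin n) ℝ ≃ₗ[ℝ] _).toLinearMap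
  have hΨ : ∀ M c, Ψ M c = M.mulVec c := fun M c => by simp [Ψ]
  have hΨc : Continuous Ψ := LinearMap.continuous_of_finiteDimensional Ψ
  let ev : (Fin n → ℝ) → (Matrix (Fin n) (Fin n) ℝ →L[ℝ] (Fin n → ℝ)) := fun c =>
    LinearMap.toContinuousLinearMap ((LinearMap.applyₗ c) ∘ₗ
      (Matrix.toLin' : Matrix (Fin n) (Fin n) ℝ ≃ₗ[ℝ] _).toLinearMap)
  have hev : ∀ M c, ev c M = M.mulVec c := fun M c => by simp [ev]
  let P : ℝ × ℝ → ℝ × ℝ := fun p => (auxCl 0 a p.1, auxCl 0 b p.2)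
  have hPm : ∀ p, P p ∈ Icc 0 a ×ˢ Icc 0 b := fun p => ⟨auxCl_mem ha.le _, auxCl_mem hb.le _⟩
  have hPc : Continuous P :=
    ((auxCl_cont _ _).comp continuous_fst).prodMk ((auxCl_cont _ _).comp continuous_snd)
  have hPe : ∀ p ∈ Icc (0:ℝ) a ×ˢ Icc (0:ℝ) b, P p = p := fun p hp => by
    simp only [P, auxCl_eq hp.1, auxCl_eq hp.2]
  have hcpt : IsCompact (Icc (0:ℝ) a ×ˢ Icc (0:ℝ) b) := isCompact_Icc.prod isCompact_Icc
  have ext : ∀ N : ℝ × ℝ → Matrix (Fin n) (Fin n) ℝ, ContinuousOn N (Icc 0 a ×ˢ Icc 0 b) →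
      ∃ (L : ℝ × ℝ → (Fin n → ℝ) →L[ℝ] (Fin n → ℝ)) (K : ℝ), Continuous L ∧ (∀ p, ‖L p‖ ≤ K) ∧
        ∀ p ∈ Icc (0:ℝ) a ×ˢ Icc (0:ℝ) b, ∀ c, L p c = (N p).mulVec c := by
    intro N hN
    have h1 : ContinuousOn (fun p => Ψ (N p)) (Icc 0 a ×ˢ Icc 0 b) := hΨc.comp_continuousOn hN
    obtain ⟨K, hK⟩ := hcpt.exists_bound_of_continuousOn h1
    refine ⟨fun p => Ψ (N (P p)), K, h1.comp_continuous hPc hPm, fun p => hK _ (hPm p), ?_⟩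
    intro p hp c
    simp only [hPe p hp, hΨ]
  obtain ⟨A', KA, hA1, hA2, hA3⟩ := ext A hA
  obtain ⟨B', KB, hB1, hB2, hB3⟩ := ext B hB
  obtain ⟨C', KC, hC1, hC2, hC3⟩ := ext C hC
  obtain ⟨w', Kw, hw1, hw2, hw3⟩ : ∃ (w' : ℝ × ℝ → Fin n → ℝ) (K : ℝ), Continuous w' ∧
      (∀ p, ‖w' p‖ ≤ K) ∧ ∀ p ∈ Icc (0:ℝ) a ×ˢ Icc (0:ℝ) b, w' p = w p := by
    obtain ⟨K, hK⟩ := hcpt.exists_bound_of_continuousOn hw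
    exact ⟨fun p => w (P p), K, hw.comp_continuous hPc hPm, fun p => hK _ (hPm p),
      fun p hp => by simp only [hPe p hp]⟩
  obtain ⟨K, hKA, hKB, hKC, hKw⟩ : ∃ K, KA ≤ K ∧ KB ≤ K ∧ KC ≤ K ∧ Kw ≤ K :=
    ⟨max (max KA KB) (max KC Kw), by simp, by simp, by simp, by simp⟩
  have hA2' : ∀ p, ‖A' p‖ ≤ K := fun p => (hA2 p).trans hKA
  have hB2' : ∀ p, ‖B' p‖ ≤ K := fun p => (hB2 p).trans hKB
  have hC2' : ∀ p, ‖C' p‖ ≤ K := fun p => (hC2 p).trans hKC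
  obtain ⟨r, v, u, F, hr, hv, hu, hF, eF, e0, eC, eB, es, et, est⟩ :=
    aux_riemann A' B' C' hA1 hB1 hC1 w' hw1 K hA2' hB2' hC2' (fun p => (hw2 p).trans hKw)
  -- the given Riemann function agrees with the constructed one
  have hRr : ∀ σ τ, 0 ≤ σ → σ < a → 0 ≤ τ → τ < b → ∀ s ∈ Icc σ a, ∀ t ∈ Icc τ b,
      (R (s, t) (σ, τ)).mulVec (w (σ, τ)) = r (s, t, σ, τ) := by
    intro σ τ hσ0 hσ hτ0 hτ s hs t ht
    have hq : (σ, τ) ∈ Icc (0:ℝ) a ×ˢ Icc (0:ℝ) b := ⟨⟨hσ0, hσ.le⟩, ⟨hτ0, hτ.le⟩⟩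
    have hsub : ∀ p ∈ Icc σ a ×ˢ Icc τ b, p ∈ Icc (0:ℝ) a ×ˢ Icc (0:ℝ) b := fun p hp =>
      ⟨⟨hσ0.trans hp.1.1, hp.1.2⟩, ⟨hτ0.trans hp.2.1, hp.2.2⟩⟩
    obtain ⟨k1, k2, k3, k4⟩ := hRcont _ hq
    have hdv := hRderiv _ hq
    obtain ⟨i1, i2, i3, i4⟩ := hRinit _ hq
    have hc : ∀ (N : ℝ × ℝ → ℝ × ℝ → Matrix (Fin n) (Fin n) ℝ) (f : ℝ × ℝ × ℝ × ℝ → Fin n → ℝ),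
        Continuous f → ContinuousOn (fun p => N p (σ, τ)) (Icc σ a ×ˢ Icc τ b) →
        ContinuousOn (fun p : ℝ × ℝ => ev (w (σ, τ)) (N p (σ, τ)) - f (p.1, p.2, σ, τ))
          (Icc σ a ×ˢ Icc τ b) := by
      intro N f hf hN
      refine ((ev (w (σ, τ))).continuous.comp_continuousOn hN).sub ?_
      exact Continuous.continuousOn (by fun_prop)
    have hder : ∀ (f g : ℝ → Fin n → ℝ) (c d : ℝ), Continuous g →
        (∀ z, f z = d • f c + (1 - d) • f c + ∫ x in c..z, g x) → ∀ z, HasDerivAt f (g z) z := by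
      intro f g c d hg hf z
      have h1 : f = fun z => f c + ∫ x in c..z, g x := by
        funext z
        rw [hf z, ← add_smul]; simp
      rw [h1]
      exact ((hg.integral_hasStrictDerivAt c z).hasDerivAt).const_add _
    have := aux_unique σ a τ b hσ hτ A' B' C' K hA2' hB2' hC2'
      (fun p => ev (w (σ, τ)) (R p (σ, τ)) - r (p.1, p.2, σ, τ))
      (fun p => ev (w (σ, τ)) (Rs p (σ, τ)) - v (p.1, p.2, σ, τ))
      (fun p => ev (w (σ, τ)) (Rt p (σ, τ)) - u (p.1, p.2, σ, τ))
      (fun p => ev (w (σ, τ)) (Rst p (σ, τ)) - F (p.1, p.2, σ, τ))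
      (hc R r hr k1) (hc Rs v hv k2) (hc Rt u hu k3) (hc Rst F hF k4) ?_ ?_ ?_ ?_ (s, t) ⟨hs, ht⟩
    · rw [sub_eq_zero, hev] at this
      exact this
    · rintro ⟨s, t⟩ hp
      obtain ⟨j1, j2, j3⟩ := hdv _ hp
      refine ⟨?_, ?_, ?_, ?_⟩
      · refine ((ev (w (σ, τ))).hasFDerivAt.comp_hasDerivWithinAt _ j1).sub ?_
        exact (hder (fun s => r (s, t, σ, τ)) (fun s => v (s, t, σ, τ)) σ 0 (by fun_prop)
          (fun z => by simpa using es z t σ τ) s).hasDerivWithinAt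
      · refine ((ev (w (σ, τ))).hasFDerivAt.comp_hasDerivWithinAt _ j2).sub ?_
        exact (hder (fun t => r (s, t, σ, τ)) (fun t => u (s, t, σ, τ)) τ 0 (by fun_prop)
          (fun z => by simpa using et s z σ τ) t).hasDerivWithinAt
      · refine ((ev (w (σ, τ))).hasFDerivAt.comp_hasDerivWithinAt _ j3).sub ?_
        exact (hder (fun t => v (s, t, σ, τ)) (fun t => F (s, t, σ, τ)) τ 0 (by fun_prop)
          (fun z => by simpa using est s z σ τ) t).hasDerivWithinAt
      · simp only [map_sub, eF, hev]
        rw [i4 _ hp]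
        simp only [hA3 _ (hsub _ hp), hB3 _ (hsub _ hp), hC3 _ (hsub _ hp), Matrix.add_mulVec, Matrix.mulVec_mulVec]
        abel
    · simp only [hev]
      rw [i1, e0, hw3 _ hq]
      simp
    · intro s hs
      have hp := hsub (s, τ) ⟨hs, ⟨le_rfl, hτ.le⟩⟩
      simp only [hev, map_sub]
      rw [i2 s hs, eC]
      simp only [hC3 _ hp, Matrix.mulVec_mulVec]
    · intro t ht
      have hp := hsub (σ, t) ⟨⟨le_rfl, hσ.le⟩, ht⟩
      simp only [hev, map_sub]
      rw [i3 t ht, eB]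
      simp only [hB3 _ hp, Matrix.mulVec_mulVec]
  obtain ⟨y', hy'⟩ : ∃ y' : ℝ × ℝ → Fin n → ℝ, ∀ p : ℝ × ℝ, y' p =
      ∫ σ in (0:ℝ)..p.1, ∫ τ in (0:ℝ)..p.2, r (p.1, p.2, σ, τ) := ⟨_, fun _ => rfl⟩
  have hyy : ∀ p ∈ Icc (0:ℝ) a ×ˢ Icc (0:ℝ) b, y p = y' p := by
    rintro ⟨s, t⟩ hp
    obtain ⟨hs, ht⟩ : s ∈ Icc 0 a ∧ t ∈ Icc 0 b := hp
    have hne : ∀ c : ℝ, ∀ᵐ x : ℝ, x ≠ c := fun c => by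
      rw [ae_iff]; simp
    rw [hy, hy']
    simp only
    refine intervalIntegral.integral_congr_ae ?_
    filter_upwards [hne s] with σ hσ hσm
    rw [uIoc_of_le hs.1] at hσm
    refine intervalIntegral.integral_congr_ae ?_
    filter_upwards [hne t] with τ hτ hτm
    rw [uIoc_of_le ht.1] at hτm
    exact hRr σ τ hσm.1.le ((lt_of_le_of_ne hσm.2 hσ).trans_le hs.2) hτm.1.le
      ((lt_of_le_of_ne hτm.2 hτ).trans_le ht.2) s ⟨hσm.2, hs.2⟩ t ⟨hτm.2, ht.2⟩
  obtain ⟨ys, yt, yst, cy, cys, cyt, cyst, hyd⟩ := aux_superposition A' B' C' hA1 hB1 hC1 w' hw1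
    r v u F hr hv hu hF eF e0 eC eB es et est y' hy'
  have hys0 : ∀ s, y' (s, 0) = 0 := fun s => by rw [hy']; simp
  have hyt0 : ∀ t, y' (0, t) = 0 := fun t => by rw [hy']; simp
  have m0a : (0:ℝ) ∈ Icc 0 a := ⟨le_rfl, ha.le⟩
  have m0b : (0:ℝ) ∈ Icc 0 b := ⟨le_rfl, hb.le⟩
  refine ⟨⟨ys, yt, yst, cy.continuousOn.congr hyy, cys.continuousOn, cyt.continuousOn,
    cyst.continuousOn, ?_, ?_, ?_⟩, ?_⟩
  · rintro ⟨s, t⟩ hp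
    obtain ⟨d1, d2, d3, d4⟩ := hyd (s, t)
    refine ⟨d1.hasDerivWithinAt.congr (fun z hz => hyy _ ⟨hz, hp.2⟩) (hyy _ hp),
      d2.hasDerivWithinAt.congr (fun z hz => hyy _ ⟨hp.1, hz⟩) (hyy _ hp),
      d3.hasDerivWithinAt, ?_⟩
    rw [d4, hA3 _ hp, hB3 _ hp, hC3 _ hp, hw3 _ hp, hyy _ hp]
  · intro s hs
    rw [hyy _ ⟨hs, m0b⟩, hys0]
  · intro t ht
    rw [hyy _ ⟨m0a, ht⟩, hyt0]
  · rintro z ⟨zs, zt, zst, cz, czs, czt, czst, hzd, hzs0, hzt0⟩ p hp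
    rw [hyy p hp]
    have hx : ∀ q ∈ Icc (0:ℝ) a ×ˢ Icc (0:ℝ) b,
        HasDerivWithinAt (fun s => z (s, q.2) - y' (s, q.2)) (zs q - ys q) (Icc 0 a) q.1 ∧
        HasDerivWithinAt (fun t => z (q.1, t) - y' (q.1, t)) (zt q - yt q) (Icc 0 b) q.2 ∧
        HasDerivWithinAt (fun t => zs (q.1, t) - ys (q.1, t)) (zst q - yst q) (Icc 0 b) q.2 ∧
        zst q - yst q = A' q (z q - y' q) + B' q (zs q - ys q) + C' q (zt q - yt q) := by
      intro q hq
      obtain ⟨d1, d2, d3, d4⟩ := hyd q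
      obtain ⟨f1, f2, f3, f4⟩ := hzd q hq
      refine ⟨f1.sub d1.hasDerivWithinAt, f2.sub d2.hasDerivWithinAt,
        f3.sub d3.hasDerivWithinAt, ?_⟩
      rw [f4, d4, hw3 q hq]
      simp only [hA3 q hq, hB3 q hq, hC3 q hq, Matrix.mulVec_sub]
      abel
    have h := aux_unique 0 a 0 b ha hb A' B' C' K hA2' hB2' hC2'
      (fun p => z p - y' p) (fun p => zs p - ys p) (fun p => zt p - yt p)
      (fun p => zst p - yst p) (cz.sub cy.continuousOn) (czs.sub cys.continuousOn)
      (czt.sub cyt.continuousOn) (czst.sub cyst.continuousOn) hx ?_ ?_ ?_ p hp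
    · exact sub_eq_zero.1 h
    · simp only [hzs0 0 m0a, hys0, sub_zero]
    · intro s hs
      have d1 := (hx (s, 0) ⟨hs, m0b⟩).1
      have d2 : HasDerivWithinAt (fun s => z (s, 0) - y' (s, 0)) 0 (Icc 0 a) s :=
        (hasDerivWithinAt_const s (Icc 0 a) (0 : Fin n → ℝ)).congr
          (fun x hx => by simp only [hzs0 x hx, hys0, sub_zero])
          (by simp only [hzs0 s hs, hys0, sub_zero])
      have e := (uniqueDiffOn_Icc ha s hs).eq_deriv _ d1 d2
      simp only [e, hzs0 s hs, hys0, sub_zero, map_zero]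
    · intro t ht
      have d1 := (hx (0, t) ⟨m0a, ht⟩).2.1
      have d2 : HasDerivWithinAt (fun t => z (0, t) - y' (0, t)) 0 (Icc 0 b) t :=
        (hasDerivWithinAt_const t (Icc 0 b) (0 : Fin n → ℝ)).congr
          (fun x hx => by simp only [hzt0 x hx, hyt0, sub_zero])
          (by simp only [hzt0 t ht, hyt0, sub_zero])
      have e := (uniqueDiffOn_Icc hb t ht).eq_deriv _ d1 d2
      simp only [e, hzt0 t ht, hyt0, sub_zero, map_zero]
end
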